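/- Let n ≥ 3, m ≥ 2, and for each ε ∈ (0, 4/(n−2)) let u_ε be a radial Dirichlet solution with exactly m−1 interior zeros, with largest critical point δ_{1,ε}. Then, as ε → 0⁺: |u_ε(δ_{1,ε})|^{1 − ε(n−2)/2} · |u_ε'(1)| → (n(n−2))^{n/2} / n. -/

import Mathlib

open Real Set Filter Topology MeasureTheory

noncomputable section

/-- `κ_n = ((n-2)/4) · Γ(n/2)² / Γ(n)`. -/
def kappa (n : ℕ) : ℝ :=
  (((n : ℝ) - 2) / 4) * Real.Gamma ((n : ℝ) / 2) ^ 2 / Real.Gamma (n : ℝ)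

/-- `p_ε = (n+2)/(n-2) - ε`. -/
def pEps (n : ℕ) (ε : ℝ) : ℝ := ((n : ℝ) + 2) / ((n : ℝ) - 2) - ε

/-- `u ∈ C²([0,1])` is a radial solution of `-Δu = |u|^{p-1} u` on the unit ball of `ℝⁿ`,
written in the radial variable: `(r^{n-1} u')' = -|u|^{p-1} u · r^{n-1}` on `(0,1]`,
with `u'(0) = 0`. -/
def IsRadialSolution (n : ℕ) (p : ℝ) (u : ℝ → ℝ) : Prop :=
  ContDiffOn ℝ 2 u (Set.Icc 0 1) ∧ deriv u 0 = 0 ∧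
    ∀ r ∈ Set.Ioc (0 : ℝ) 1,
      deriv (fun s => s ^ (n - 1) * deriv u s) r = -(|u r| ^ (p - 1) * u r * r ^ (n - 1))

/-- Radial Dirichlet solution with exactly `m-1` interior zeros, together with the
decreasing enumeration of its zeros `ρ 1 = 1 > ρ 2 > … > ρ m > 0` in `(0,1]` and of its
critical points `1 > δ 1 > … > δ m = 0` in `[0,1]`, interlaced as
`0 = δ m < ρ m < δ (m-1) < … < δ 1 < ρ 1 = 1`. -/
def DirichletData (n : ℕ) (p : ℝ) (m : ℕ) (u : ℝ → ℝ) (ρ δ : ℕ → ℝ) : Prop :=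
  IsRadialSolution n p u ∧ u 1 = 0 ∧ ρ 1 = 1 ∧ δ m = 0 ∧
    (∀ k, 1 ≤ k → k ≤ m → δ k < ρ k) ∧
    (∀ k, 1 ≤ k → k + 1 ≤ m → ρ (k + 1) < δ k) ∧
    {r : ℝ | r ∈ Set.Ioc (0 : ℝ) 1 ∧ u r = 0} = ρ '' Set.Icc 1 m ∧
    {r : ℝ | r ∈ Set.Icc (0 : ℝ) 1 ∧ deriv u r = 0} = δ '' Set.Icc 1 m

/-- Radial Neumann solution with exactly `m-1` interior zeros, together with the
decreasing enumeration of its zeros `1 > ρ 1 > … > ρ (m-1) > 0` in `(0,1)` and of its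
critical points `δ 1 = 1 > δ 2 > … > δ m = 0` in `[0,1]`, interlaced as
`0 = δ m < ρ (m-1) < δ (m-1) < … < ρ 1 < δ 1 = 1`. -/
def NeumannData (n : ℕ) (p : ℝ) (m : ℕ) (u : ℝ → ℝ) (ρ δ : ℕ → ℝ) : Prop :=
  IsRadialSolution n p u ∧ deriv u 1 = 0 ∧ δ 1 = 1 ∧ δ m = 0 ∧
    (∀ k, 1 ≤ k → k ≤ m - 1 → ρ k < δ k) ∧
    (∀ k, 1 ≤ k → k ≤ m - 1 → δ (k + 1) < ρ k) ∧
    {r : ℝ | r ∈ Set.Ioo (0 : ℝ) 1 ∧ u r = 0} = ρ '' Set.Icc 1 (m - 1) ∧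
    {r : ℝ | r ∈ Set.Icc (0 : ℝ) 1 ∧ deriv u r = 0} = δ '' Set.Icc 1 m

/-- A nontrivial radial Dirichlet solution with exactly `m-1` interior zeros. -/
def DirichletSol (n : ℕ) (p : ℝ) (m : ℕ) (u : ℝ → ℝ) : Prop :=
  IsRadialSolution n p u ∧ u 1 = 0 ∧ (∃ r ∈ Set.Icc (0 : ℝ) 1, u r ≠ 0) ∧
    ∃ Z : Finset ℝ, (Z : Set ℝ) = {r | r ∈ Set.Ioo (0 : ℝ) 1 ∧ u r = 0} ∧ Z.card = m - 1

/-- A nontrivial radial Neumann solution with exactly `m-1` interior zeros. -/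
def NeumannSol (n : ℕ) (p : ℝ) (m : ℕ) (u : ℝ → ℝ) : Prop :=
  IsRadialSolution n p u ∧ deriv u 1 = 0 ∧ (∃ r ∈ Set.Icc (0 : ℝ) 1, u r ≠ 0) ∧
    ∃ Z : Finset ℝ, (Z : Set ℝ) = {r | r ∈ Set.Ioo (0 : ℝ) 1 ∧ u r = 0} ∧ Z.card = m - 1


/-- monotonicity from a nonnegative derivative. -/
lemma mono_of_hd {f f' : ℝ → ℝ} {a b : ℝ} (hc : ContinuousOn f (Icc a b))
    (hd : ∀ x ∈ Ioo a b, HasDerivAt f (f' x) x) (hn : ∀ x ∈ Ioo a b, 0 ≤ f' x) :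
    MonotoneOn f (Icc a b) := by
  apply monotoneOn_of_deriv_nonneg (convex_Icc a b) hc
  · intro x hx
    rw [interior_Icc] at hx
    exact (hd x hx).differentiableAt.differentiableWithinAt
  · intro x hx
    rw [interior_Icc] at hx
    rw [(hd x hx).deriv]
    exact hn x hx

/-- A rescaled bubble profile `v` with flux `q` on `[s0, g]`. -/
structure Bub (d : ℕ) (e s0 g : ℝ) (v q : ℝ → ℝ) : Prop where
  hs0 : 0 < s0
  lt : s0 < g
  cv : ContinuousOn v (Icc s0 g)
  cq : ContinuousOn q (Icc s0 g)
  dv : ∀ s ∈ Ioo s0 g, HasDerivAt v (-(q s / s ^ d)) s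
  dq : ∀ s ∈ Ioo s0 g, HasDerivAt q (v s ^ (2 * e + 1) * s ^ d) s
  v0 : v s0 = 1
  q0 : q s0 = 0
  v1 : v g = 0
  vpos : ∀ s ∈ Ico s0 g, 0 < v s

namespace Bub
variable {d : ℕ} {e s0 g : ℝ} {v q : ℝ → ℝ}

lemma qmono (h : Bub d e s0 g v q) : MonotoneOn q (Icc s0 g) := by
  refine mono_of_hd h.cq h.dq ?_
  intro s hs
  have h1 := h.vpos s ⟨hs.1.le, hs.2⟩
  have h2 : 0 < s := h.hs0.trans hs.1
  positivity

lemma qnonneg (h : Bub d e s0 g v q) {s : ℝ} (hs : s ∈ Icc s0 g) : 0 ≤ q s := by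
  rw [← h.q0]
  exact h.qmono ⟨le_rfl, h.lt.le⟩ hs hs.1

lemma vanti (h : Bub d e s0 g v q) {s t : ℝ} (hs : s ∈ Icc s0 g) (ht : t ∈ Icc s0 g)
    (hst : s ≤ t) : v t ≤ v s := by
  have := mono_of_hd (f := fun x => - v x) h.cv.neg (fun x hx => (h.dv x hx).neg) (by
    intro x hx
    have h2 : 0 < x := h.hs0.trans hx.1
    have := h.qnonneg ⟨hx.1.le, hx.2.le⟩
    rw [neg_neg]
    positivity) hs ht hst
  simpa using this

lemma vnonneg (h : Bub d e s0 g v q) {s : ℝ} (hs : s ∈ Icc s0 g) : 0 ≤ v s := by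
  rw [← h.v1]
  exact h.vanti hs ⟨h.lt.le, le_rfl⟩ hs.2

lemma vle1 (h : Bub d e s0 g v q) {s : ℝ} (hs : s ∈ Icc s0 g) : v s ≤ 1 := by
  rw [← h.v0]
  exact h.vanti ⟨le_rfl, h.lt.le⟩ hs hs.1

lemma qle (h : Bub d e s0 g v q) (he : 0 ≤ e) {s : ℝ} (hs : s ∈ Icc s0 g) :
    q s ≤ s ^ (d + 1) / ((d : ℝ) + 1) := by
  have hm := mono_of_hd (f := fun x => x ^ (d + 1) / ((d : ℝ) + 1) - q x)
    (f' := fun x => x ^ d - v x ^ (2 * e + 1) * x ^ d)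
    (ContinuousOn.sub (by fun_prop) h.cq) (fun x hx => by
      refine HasDerivAt.sub ?_ (h.dq x hx)
      have := (hasDerivAt_pow (d + 1) x).div_const ((d : ℝ) + 1)
      refine HasDerivAt.congr_deriv this ?_
      push_cast
      field_simp) (by
    intro x hx
    have h2 : 0 < x := h.hs0.trans hx.1
    have h3 := h.vle1 ⟨hx.1.le, hx.2.le⟩
    have h4 := h.vnonneg ⟨hx.1.le, hx.2.le⟩
    have h5 : v x ^ (2 * e + 1) ≤ 1 := Real.rpow_le_one h4 h3 (by linarith)
    have h6 : 0 < x ^ d := by positivity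
    nlinarith) ⟨le_rfl, h.lt.le⟩ hs hs.1
  simp only [h.q0] at hm
  have := h.hs0
  have h7 : 0 < s0 ^ (d + 1) / ((d : ℝ) + 1) := by positivity
  linarith

lemma vge (h : Bub d e s0 g v q) (he : 0 ≤ e) {s : ℝ} (hs : s ∈ Icc s0 g) :
    1 - s ^ 2 / (2 * ((d : ℝ) + 1)) ≤ v s := by
  have hm := mono_of_hd (f := fun x => x ^ 2 / (2 * ((d : ℝ) + 1)) + v x)
    (f' := fun x => x / ((d : ℝ) + 1) + -(q x / x ^ d))
    (ContinuousOn.add (by fun_prop) h.cv) (fun x hx => by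
      refine HasDerivAt.add ?_ (h.dv x hx)
      have := (hasDerivAt_pow 2 x).div_const (2 * ((d : ℝ) + 1))
      refine HasDerivAt.congr_deriv this ?_
      push_cast
      field_simp) (by
    intro x hx
    have h2 : 0 < x := h.hs0.trans hx.1
    have h3 := h.qle he ⟨hx.1.le, hx.2.le⟩
    have h6 : 0 < x ^ d := by positivity
    have : q x / x ^ d ≤ x / ((d : ℝ) + 1) := by
      rw [div_le_iff₀ h6]
      calc q x ≤ _ := h3
        _ = _ := by ring
    linarith) ⟨le_rfl, h.lt.le⟩ hs hs.1
  simp only [h.v0] at hm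
  have := h.hs0
  have h7 : 0 < s0 ^ 2 / (2 * ((d : ℝ) + 1)) := by positivity
  linarith

lemma gge (h : Bub d e s0 g v q) (he : 0 ≤ e) : 2 * ((d : ℝ) + 1) ≤ g ^ 2 := by
  have := h.vge he ⟨h.lt.le, le_rfl⟩
  rw [h.v1] at this
  have h1 : 1 ≤ g ^ 2 / (2 * ((d : ℝ) + 1)) := by linarith
  rwa [le_div_iff₀ (by positivity), one_mul] at h1

lemma qge (h : Bub d e s0 g v q) (he : 0 ≤ e) {s : ℝ} (hs : s ∈ Icc s0 g) :
    v s ^ (2 * e + 1) * (s ^ (d + 1) - s0 ^ (d + 1)) / ((d : ℝ) + 1) ≤ q s := by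
  have hm := mono_of_hd (a := s0) (b := s)
    (f := fun x => q x - v s ^ (2 * e + 1) * (x ^ (d + 1) / ((d : ℝ) + 1)))
    (f' := fun x => v x ^ (2 * e + 1) * x ^ d - v s ^ (2 * e + 1) * x ^ d)
    (ContinuousOn.sub (h.cq.mono (Icc_subset_Icc_right hs.2)) (by fun_prop)) (fun x hx => by
      refine HasDerivAt.sub (h.dq x ⟨hx.1, hx.2.trans_le hs.2⟩) ?_
      have := ((hasDerivAt_pow (d + 1) x).div_const ((d : ℝ) + 1)).const_mul (v s ^ (2 * e + 1))
      refine HasDerivAt.congr_deriv this ?_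
      push_cast
      field_simp) (by
    intro x hx
    have h2 : 0 < x := h.hs0.trans hx.1
    have h3 := h.vanti ⟨hx.1.le, hx.2.le.trans hs.2⟩ hs hx.2.le
    have h4 := h.vnonneg hs
    have h5 : v s ^ (2 * e + 1) ≤ v x ^ (2 * e + 1) := Real.rpow_le_rpow h4 h3 (by linarith)
    have h6 : 0 < x ^ d := by positivity
    nlinarith) ⟨le_rfl, hs.1⟩ ⟨hs.1, le_rfl⟩ hs.1
  simp only [h.q0] at hm
  have e1 : v s ^ (2 * e + 1) * (s ^ (d + 1) - s0 ^ (d + 1)) / ((d : ℝ) + 1)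
    = v s ^ (2 * e + 1) * (s ^ (d + 1) / ((d : ℝ) + 1)) -
      v s ^ (2 * e + 1) * (s0 ^ (d + 1) / ((d : ℝ) + 1)) := by ring
  linarith

/-- Pohozaev positivity. -/
lemma poho (h : Bub d e s0 g v q) (he : 0 < e) {κ : ℝ} (hκ : 0 ≤ κ)
    (hek : ((d : ℝ) - 1) * e = 2 - κ) {s : ℝ} (hs : s ∈ Ico s0 g) :
    0 ≤ s * q s ^ 2 / (2 * s ^ d) + s ^ (d + 1) * v s ^ (2 * e + 2) / (2 * e + 2)
      - ((d : ℝ) - 1) / 2 * (v s * q s) := by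
  have hm := mono_of_hd (a := s0) (b := s)
    (f := fun s => s * q s ^ 2 / (2 * s ^ d) + s ^ (d + 1) * v s ^ (2 * e + 2) / (2 * e + 2)
      - ((d : ℝ) - 1) / 2 * (v s * q s))
    (f' := fun x => κ / (2 * e + 2) * (x ^ d * v x ^ (2 * e + 2))) (by
      have c1 := h.cq.mono (Icc_subset_Icc_right hs.2.le)
      have c2 := h.cv.mono (Icc_subset_Icc_right hs.2.le)
      have : ∀ x ∈ Icc s0 s, 2 * x ^ d ≠ 0 := by
        intro x hx
        have := h.hs0.trans_le hx.1
        positivity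
      have c3 : ContinuousOn (fun x => v x ^ (2 * e + 2)) (Icc s0 s) :=
        c2.rpow_const (fun x hx => Or.inr (by linarith))
      fun_prop (disch := assumption)) (fun x hx => by
      have hx0 : 0 < x := h.hs0.trans hx.1
      have hx' : x ∈ Ioo s0 g := ⟨hx.1, hx.2.trans hs.2⟩
      have hvx := h.vpos x ⟨hx.1.le, hx'.2⟩
      have hd0 : x ^ d ≠ 0 := by positivity
      have a1 := (h.dv x hx')
      have a2 := (h.dq x hx')
      have a3 := ((hasDerivAt_id x).mul (a2.pow 2)).div ((hasDerivAt_pow d x).const_mul 2)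
        (by positivity)
      have a4 := (((hasDerivAt_pow (d + 1) x).mul
        (a1.rpow_const (p := 2 * e + 2) (Or.inl hvx.ne'))).div_const (2 * e + 2))
      have a5 := (a3.add a4).sub ((a1.mul a2).const_mul (((d : ℝ) - 1) / 2))
      refine HasDerivAt.congr_deriv a5 ?_
      have hd1 : x ^ (d - 1) * d = x ^ d * d / x := by
        rcases d with _ | d
        · simp
        · simp [pow_succ]; field_simp
      have hd1' : (d : ℝ) * x ^ (d - 1) = x ^ d * d / x := by rw [mul_comm, hd1]
      have r1 : v x ^ (2 * e + 2) = v x ^ (2 * e + 1) * v x := by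
        rw [← Real.rpow_add_one hvx.ne']; ring_nf
      have r2 : v x ^ (2 * e + 2 - 1) = v x ^ (2 * e + 1) := by ring_nf
      have hk : κ = 2 - ((d : ℝ) - 1) * e := by linarith
      have he2 : 2 * e + 2 ≠ 0 := by positivity
      simp only [id, hd1', r1, r2, hk, Pi.mul_apply, Pi.pow_apply, Nat.add_sub_cancel]
      push_cast
      field_simp
      ring) (by
    intro x hx
    have hx0 : 0 < x := h.hs0.trans hx.1
    have hvx := h.vpos x ⟨hx.1.le, hx.2.trans hs.2⟩
    positivity) ⟨le_rfl, hs.1⟩ ⟨hs.1, le_rfl⟩ hs.1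
  refine le_trans ?_ hm
  have := h.hs0
  simp only [h.q0, h.v0]
  simp
  positivity

lemma psi (h : Bub d e s0 g v q) (he : 0 < e) {κ : ℝ} (hκ : 0 ≤ κ)
    (hek : ((d : ℝ) - 1) * e = 2 - κ) {s1 s : ℝ} (hs1 : s0 ≤ s1) (hss : s1 ≤ s) (hs : s < g) :
    q s1 * s1 ^ (κ - d - 1) * v s1 ^ (-(e + 1)) ≤ q s * s ^ (κ - d - 1) * v s ^ (-(e + 1)) := by
  refine mono_of_hd (a := s1) (b := s)
    (f := fun s => q s * s ^ (κ - d - 1) * v s ^ (-(e + 1)))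
    (f' := fun x => x ^ (κ - d - 1) * v x ^ (-(e + 1)) * ((2 * e + 2) / (v x * x)) *
      (x * q x ^ 2 / (2 * x ^ d) + x ^ (d + 1) * v x ^ (2 * e + 2) / (2 * e + 2)
      - ((d : ℝ) - 1) / 2 * (v x * q x))) ?_ ?_ ?_ ⟨le_rfl, hss⟩ ⟨hss, le_rfl⟩ hss
  · have c1 := h.cq.mono (Icc_subset_Icc hs1 hs.le)
    have c2 := h.cv.mono (Icc_subset_Icc hs1 hs.le)
    have c3 : ContinuousOn (fun x => v x ^ (-(e + 1))) (Icc s1 s) :=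
        c2.rpow_const (fun x hx => Or.inl (h.vpos x ⟨hs1.trans hx.1, hx.2.trans_lt hs⟩).ne')
    have c4 : ContinuousOn (fun x : ℝ => x ^ (κ - d - 1)) (Icc s1 s) :=
        continuousOn_id.rpow_const (fun x hx => Or.inl (h.hs0.trans_le (hs1.trans hx.1)).ne')
    exact (c1.mul c4).mul c3
  · intro x hx
    have hx0 : 0 < x := h.hs0.trans_le (hs1.trans hx.1.le)
    have hx' : x ∈ Ioo s0 g := ⟨hs1.trans_lt hx.1, hx.2.trans hs⟩
    have hvx := h.vpos x ⟨hx'.1.le, hx'.2⟩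
    have hd0 : x ^ d ≠ 0 := by positivity
    have a1 := (h.dv x hx')
    have a2 := (h.dq x hx')
    have a3 := (a2.mul (Real.hasDerivAt_rpow_const (p := κ - d - 1) (Or.inl hx0.ne'))).mul
      (a1.rpow_const (p := -(e + 1)) (Or.inl hvx.ne'))
    refine HasDerivAt.congr_deriv a3 ?_
    have r1 : v x ^ (2 * e + 2) = v x ^ (2 * e + 1) * v x := by
      rw [← Real.rpow_add_one hvx.ne']; ring_nf
    have r2 : v x ^ (-(e + 1) - 1) = v x ^ (-(e + 1)) / v x := Real.rpow_sub_one hvx.ne' _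
    have r3 : x ^ (κ - d - 1 - 1) = x ^ (κ - d - 1) / x := Real.rpow_sub_one hx0.ne' _
    have hk : κ - d - 1 = -(((d : ℝ) - 1) * (e + 1)) := by linarith
    simp only [r1, r2, r3, Pi.mul_apply]
    generalize x ^ (κ - d - 1) = X
    rw [hk]
    field_simp
    ring
  · intro x hx
    have hx0 : 0 < x := h.hs0.trans_le (hs1.trans hx.1.le)
    have hx' : x ∈ Ico s0 g := ⟨hs1.trans hx.1.le, hx.2.trans hs⟩
    have hvx := h.vpos x hx'
    exact mul_nonneg (by positivity) (h.poho he hκ hek hx')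

end Bub

/-- dominating density -/
def Fe (d : ℕ) (κ a c τ : ℝ) : ℝ :=
  (1 + a / ((d : ℝ) - 1) * max 0 (τ ^ (2 - κ) - c)) ^ (-(2 + ((d : ℝ) - 1) / (2 - κ))) * τ ^ d

/-- base of the bubble -/
def B0 (d : ℕ) (τ : ℝ) : ℝ := 1 + τ ^ 2 / (((d : ℝ) - 1) * ((d : ℝ) + 1))

def F0 (d : ℕ) (τ : ℝ) : ℝ := B0 d τ ^ (-(((d : ℝ) + 3) / 2)) * τ ^ d

def I0 (d : ℕ) (s : ℝ) : ℝ := s ^ (d + 1) / ((d : ℝ) + 1) * B0 d s ^ (-(((d : ℝ) + 1) / 2))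

def V0 (d : ℕ) (s : ℝ) : ℝ := B0 d s ^ (-(((d : ℝ) - 1) / 2))

lemma B0_ge {d : ℕ} (hd : 2 ≤ d) (τ : ℝ) : 1 ≤ B0 d τ := by
  have : (2 : ℝ) ≤ d := by exact_mod_cast hd
  unfold B0
  have : 0 ≤ τ ^ 2 / (((d : ℝ) - 1) * ((d : ℝ) + 1)) :=
    div_nonneg (sq_nonneg _) (mul_nonneg (by linarith) (by linarith))
  linarith

lemma B0_pos {d : ℕ} (hd : 2 ≤ d) (τ : ℝ) : 0 < B0 d τ := by linarith [B0_ge hd τ]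

lemma hasDerivAt_B0 (d : ℕ) (τ : ℝ) :
    HasDerivAt (B0 d) (2 * τ / (((d : ℝ) - 1) * ((d : ℝ) + 1))) τ := by
  have := ((hasDerivAt_pow 2 τ).div_const (((d : ℝ) - 1) * ((d : ℝ) + 1))).const_add 1
  refine HasDerivAt.congr_deriv this ?_
  norm_num

lemma continuous_B0 (d : ℕ) : Continuous (B0 d) := by unfold B0; fun_prop

lemma continuous_F0 {d : ℕ} (hd : 2 ≤ d) : Continuous (F0 d) := by
  unfold F0
  exact ((continuous_B0 d).rpow_const (fun x => Or.inl (B0_pos hd x).ne')).mul (by fun_prop)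

lemma continuous_Fe {d : ℕ} (hd : 2 ≤ d) {κ a c : ℝ} (hκ : κ < 2) (ha : 0 ≤ a) :
    Continuous (Fe d κ a c) := by
  have : (2 : ℝ) ≤ d := by exact_mod_cast hd
  unfold Fe
  have h1 : Continuous (fun τ : ℝ => τ ^ (2 - κ)) :=
    continuous_id.rpow_const (fun x => Or.inr (by linarith))
  refine Continuous.mul (Continuous.rpow_const (by fun_prop) (fun x => Or.inl ?_)) (by fun_prop)
  have : 0 ≤ a / ((d : ℝ) - 1) * max 0 (x ^ (2 - κ) - c) :=
    mul_nonneg (div_nonneg ha (by linarith)) (le_max_left _ _)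
  positivity

lemma hasDerivAt_I0 {d : ℕ} (hd : 2 ≤ d) (s : ℝ) : HasDerivAt (I0 d) (F0 d s) s := by
  have h2 : (2 : ℝ) ≤ d := by exact_mod_cast hd
  have hB := B0_pos hd s
  have := ((hasDerivAt_pow (d + 1) s).div_const ((d : ℝ) + 1)).mul
    ((hasDerivAt_B0 d s).rpow_const (p := -(((d : ℝ) + 1) / 2)) (Or.inl hB.ne'))
  refine HasDerivAt.congr_deriv this ?_
  have r1 : B0 d s ^ (-(((d : ℝ) + 1) / 2)) = B0 d s ^ (-(((d : ℝ) + 3) / 2)) * B0 d s := by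
    rw [← Real.rpow_add_one hB.ne']; ring_nf
  have r2 : B0 d s ^ (-(((d : ℝ) + 1) / 2) - 1) = B0 d s ^ (-(((d : ℝ) + 3) / 2)) := by ring_nf
  unfold F0
  rw [r1, r2]
  generalize B0 d s ^ (-(((d : ℝ) + 3) / 2)) = X
  have hne : (d : ℝ) - 1 ≠ 0 := by linarith
  have hne' : (d : ℝ) + 1 ≠ 0 := by linarith
  simp only [Nat.add_sub_cancel]
  unfold B0
  push_cast
  field_simp
  ring

lemma hasDerivAt_V0 {d : ℕ} (hd : 2 ≤ d) {s : ℝ} (hs : 0 < s) :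
    HasDerivAt (V0 d) (-(I0 d s / s ^ d)) s := by
  have h2 : (2 : ℝ) ≤ d := by exact_mod_cast hd
  have hB := B0_pos hd s
  have := ((hasDerivAt_B0 d s).rpow_const (p := -(((d : ℝ) - 1) / 2)) (Or.inl hB.ne'))
  refine HasDerivAt.congr_deriv this ?_
  have r2 : B0 d s ^ (-(((d : ℝ) - 1) / 2) - 1) = B0 d s ^ (-(((d : ℝ) + 1) / 2)) := by ring_nf
  unfold I0
  rw [r2]
  generalize B0 d s ^ (-(((d : ℝ) + 1) / 2)) = X
  have hne : (d : ℝ) - 1 ≠ 0 := by linarith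
  have hne' : (d : ℝ) + 1 ≠ 0 := by linarith
  field_simp
  ring

lemma I0_nonneg {d : ℕ} (hd : 2 ≤ d) {s : ℝ} (hs : 0 ≤ s) : 0 ≤ I0 d s := by
  have hB := B0_pos hd s
  unfold I0
  positivity

lemma V0_anti {d : ℕ} (hd : 2 ≤ d) {s t : ℝ} (hs : 0 ≤ s) (hst : s ≤ t) : V0 d t ≤ V0 d s := by
  have h2 : (2 : ℝ) ≤ d := by exact_mod_cast hd
  have : 0 < ((d : ℝ) - 1) * ((d : ℝ) + 1) := mul_pos (by linarith) (by linarith)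
  refine Real.rpow_le_rpow_of_nonpos (B0_pos hd s) ?_ (by linarith)
  unfold B0
  gcongr

lemma V0_pos {d : ℕ} (hd : 2 ≤ d) (s : ℝ) : 0 < V0 d s := Real.rpow_pos_of_pos (B0_pos hd s) _

lemma V0_le {d : ℕ} (hd : 2 ≤ d) (s : ℝ) : V0 d s ≤ 1 := by
  have h2 : (2 : ℝ) ≤ d := by exact_mod_cast hd
  exact Real.rpow_le_one_of_one_le_of_nonpos (B0_ge hd s) (by linarith)

namespace Bub
variable {d : ℕ} {e s0 g : ℝ} {v q : ℝ → ℝ}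

def aval (d : ℕ) (κ e s1 : ℝ) : ℝ :=
  s1 ^ κ * (1 - s1 ^ (d + 1)) * (1 - s1 ^ 2 / (2 * ((d : ℝ) + 1))) ^ (2 * e + 1) / ((d : ℝ) + 1)

lemma s1_lt (h : Bub d e s0 g v q) (he : 0 < e) {s1 : ℝ} (h1 : s1 < 1) : s1 < g := by
  have := h.gge he.le
  have hg : 0 < g := h.hs0.trans h.lt
  have hd : (0 : ℝ) ≤ d := Nat.cast_nonneg d
  nlinarith

lemma aval_le (h : Bub d e s0 g v q) (he : 0 < e) {κ : ℝ} {s1 : ℝ}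
    (h01 : s0 ≤ s1 ^ 2) (h1 : s1 < 1) (h1p : 0 < s1) :
    aval d κ e s1 ≤ q s1 * s1 ^ (κ - d - 1) * v s1 ^ (-(e + 1)) := by
  have hg := h.s1_lt he h1
  have h01' : s0 ≤ s1 := by nlinarith
  have hs : s1 ∈ Icc s0 g := ⟨h01', hg.le⟩
  have hv := h.vpos s1 ⟨h01', hg⟩
  have k1 := h.qge he.le hs
  have k2 := h.vge he.le hs
  have k3 : 1 ≤ v s1 ^ (-(e + 1)) :=
    Real.one_le_rpow_of_pos_of_le_one_of_nonpos hv (h.vle1 hs) (by linarith)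
  have hd : (0 : ℝ) ≤ d := Nat.cast_nonneg d
  have k4 : 0 ≤ 1 - s1 ^ 2 / (2 * ((d : ℝ) + 1)) := by
    rw [sub_nonneg, div_le_one (by positivity)]
    nlinarith
  have k5 : (1 - s1 ^ 2 / (2 * ((d : ℝ) + 1))) ^ (2 * e + 1) ≤ v s1 ^ (2 * e + 1) :=
    Real.rpow_le_rpow k4 k2 (by linarith)
  have k6 : s1 ^ (d + 1) * (1 - s1 ^ (d + 1)) ≤ s1 ^ (d + 1) - s0 ^ (d + 1) := by
    have : s0 ^ (d + 1) ≤ (s1 ^ 2) ^ (d + 1) := pow_le_pow_left₀ h.hs0.le h01 _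
    rw [← pow_mul, mul_comm 2, pow_mul] at this
    nlinarith
  have k7 : s1 ^ (κ - d - 1) * s1 ^ (d + 1) = s1 ^ κ := by
    rw [← Real.rpow_natCast, ← Real.rpow_add h1p]
    congr 1
    push_cast
    ring
  have k8 : s1 ^ (d + 1) ≤ 1 := pow_le_one₀ h1p.le h1.le
  have k9 : (1 - s1 ^ 2 / (2 * ((d : ℝ) + 1))) ^ (2 * e + 1) * (s1 ^ (d + 1) * (1 - s1 ^ (d + 1)))
      / ((d : ℝ) + 1) ≤ q s1 := by
    refine le_trans ?_ k1
    gcongr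
  have k10 : 0 ≤ q s1 := h.qnonneg hs
  calc aval d κ e s1 = (1 - s1 ^ 2 / (2 * ((d : ℝ) + 1))) ^ (2 * e + 1) *
        (s1 ^ (d + 1) * (1 - s1 ^ (d + 1))) / ((d : ℝ) + 1) * s1 ^ (κ - d - 1) := by
        unfold aval; rw [← k7]; ring
    _ ≤ q s1 * s1 ^ (κ - d - 1) := by gcongr
    _ ≤ q s1 * s1 ^ (κ - d - 1) * v s1 ^ (-(e + 1)) := le_mul_of_one_le_right (by positivity) k3

lemma psi_ge (h : Bub d e s0 g v q) (he : 0 < e) {κ : ℝ} (hκ : 0 ≤ κ)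
    (hek : ((d : ℝ) - 1) * e = 2 - κ) {s1 : ℝ}
    (h01 : s0 ≤ s1 ^ 2) (h1 : s1 < 1) (h1p : 0 < s1) {s : ℝ} (hss : s1 ≤ s) (hs : s < g) :
    aval d κ e s1 ≤ q s * s ^ (κ - d - 1) * v s ^ (-(e + 1)) :=
  (h.aval_le he h01 h1 h1p).trans (h.psi he hκ hek (by nlinarith) hss hs)

lemma qlow (h : Bub d e s0 g v q) (he : 0 < e) {κ : ℝ} (hκ : 0 ≤ κ)
    (hek : ((d : ℝ) - 1) * e = 2 - κ) {s1 : ℝ}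
    (h01 : s0 ≤ s1 ^ 2) (h1 : s1 < 1) (h1p : 0 < s1) {s : ℝ} (hss : s1 ≤ s) (hs : s < g) :
    aval d κ e s1 * s ^ (d + 1 - κ) * v s ^ (e + 1) ≤ q s := by
  have h01' : s0 ≤ s1 := by nlinarith
  have hv := h.vpos s ⟨h01'.trans hss, hs⟩
  have hs0 : 0 < s := h1p.trans_le hss
  have := h.psi_ge he hκ hek h01 h1 h1p hss hs
  have e1 : s ^ (κ - d - 1) * s ^ (d + 1 - κ) = 1 := by
    rw [← Real.rpow_add hs0]; ring_nf; exact Real.rpow_zero _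
  have e2 : v s ^ (-(e + 1)) * v s ^ (e + 1) = 1 := by
    rw [← Real.rpow_add hv]; ring_nf; exact Real.rpow_zero _
  calc aval d κ e s1 * s ^ (d + 1 - κ) * v s ^ (e + 1)
      ≤ q s * s ^ (κ - d - 1) * v s ^ (-(e + 1)) * s ^ (d + 1 - κ) * v s ^ (e + 1) := by gcongr
    _ = q s * (s ^ (κ - d - 1) * s ^ (d + 1 - κ)) * (v s ^ (-(e + 1)) * v s ^ (e + 1)) := by ring
    _ = q s := by rw [e1, e2]; ring

lemma vneg_ge (h : Bub d e s0 g v q) (he : 0 < e) {κ : ℝ} (hκ : 0 ≤ κ) (hκ2 : κ < 2)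
    (hek : ((d : ℝ) - 1) * e = 2 - κ) {s1 : ℝ}
    (h01 : s0 ≤ s1 ^ 2) (h1 : s1 < 1) (h1p : 0 < s1) {s : ℝ} (hss : s1 ≤ s) (hs : s < g) :
    1 + aval d κ e s1 / ((d : ℝ) - 1) * (s ^ (2 - κ) - s1 ^ (2 - κ)) ≤ v s ^ (-e) := by
  have h01' : s0 ≤ s1 := by nlinarith
  have hd1 : (d : ℝ) - 1 ≠ 0 := by
    intro h0
    rw [h0] at hek
    linarith
  have hm := mono_of_hd (a := s1) (b := s)
    (f := fun s => v s ^ (-e) - aval d κ e s1 / ((d : ℝ) - 1) * s ^ (2 - κ))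
    (f' := fun x => e * x ^ (1 - κ) *
      (q x * x ^ (κ - d - 1) * v x ^ (-(e + 1)) - aval d κ e s1)) ?_ ?_ ?_
      ⟨le_rfl, hss⟩ ⟨hss, le_rfl⟩ hss
  · simp only at hm
    have hv1 := h.vpos s1 ⟨h01', hss.trans_lt hs⟩
    have k3 : 1 ≤ v s1 ^ (-e) :=
      Real.one_le_rpow_of_pos_of_le_one_of_nonpos hv1
        (h.vle1 ⟨h01', hss.trans hs.le⟩) (by linarith)
    linarith
  · have c2 := h.cv.mono (Icc_subset_Icc h01' hs.le)
    have c3 : ContinuousOn (fun x => v x ^ (-e)) (Icc s1 s) :=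
        c2.rpow_const (fun x hx => Or.inl (h.vpos x ⟨h01'.trans hx.1, hx.2.trans_lt hs⟩).ne')
    have c4 : ContinuousOn (fun x : ℝ => x ^ (2 - κ)) (Icc s1 s) :=
        continuousOn_id.rpow_const (fun x hx => Or.inl (h1p.trans_le hx.1).ne')
    fun_prop
  · intro x hx
    have hx0 : 0 < x := h1p.trans hx.1
    have hx' : x ∈ Ioo s0 g := ⟨h01'.trans_lt hx.1, hx.2.trans hs⟩
    have hvx := h.vpos x ⟨hx'.1.le, hx'.2⟩
    have a1 := (h.dv x hx')
    have a3 := (a1.rpow_const (p := -e) (Or.inl hvx.ne')).sub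
      ((Real.hasDerivAt_rpow_const (p := 2 - κ) (Or.inl hx0.ne')).const_mul
        (aval d κ e s1 / ((d : ℝ) - 1)))
    refine HasDerivAt.congr_deriv a3 ?_
    have r1 : v x ^ (-e - 1) = v x ^ (-(e + 1)) := by ring_nf
    have r2 : x ^ (2 - κ - 1) = x ^ (1 - κ) := by ring_nf
    have r3 : x ^ (κ - d - 1) = (x ^ (1 - κ))⁻¹ * (x ^ d)⁻¹ := by
      rw [← Real.rpow_natCast, ← Real.rpow_neg hx0.le, ← Real.rpow_neg hx0.le,
        ← Real.rpow_add hx0]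
      ring_nf
    have : x ^ (1 - κ) ≠ 0 := by positivity
    rw [r1, r2, r3, ← hek]
    field_simp
  · intro x hx
    have hx0 : 0 < x := h1p.trans hx.1
    have := h.psi_ge he hκ hek h01 h1 h1p hx.1.le (hx.2.trans hs)
    exact mul_nonneg (by positivity) (by linarith)

lemma dens_le (h : Bub d e s0 g v q) (he : 0 < e) {κ : ℝ} (hκ : 0 ≤ κ) (hκ2 : κ < 2)
    (hd : 2 ≤ d) (hek : ((d : ℝ) - 1) * e = 2 - κ) {s1 : ℝ}
    (h01 : s0 ≤ s1 ^ 2) (h1 : s1 < 1) (h1p : 0 < s1) (ha : 0 ≤ aval d κ e s1)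
    {s : ℝ} (hss : s0 ≤ s) (hs : s < g) :
    v s ^ (2 * e + 1) * s ^ d ≤ Fe d κ (aval d κ e s1) (s1 ^ (2 - κ)) s := by
  have h2 : (2 : ℝ) ≤ d := by exact_mod_cast hd
  have hs0 : 0 < s := h.hs0.trans_le hss
  have hv := h.vpos s ⟨hss, hs⟩
  have hexp : ((d : ℝ) - 1) / (2 - κ) = 1 / e := by
    rw [← hek]
    have : (d : ℝ) - 1 ≠ 0 := by linarith
    field_simp
  unfold Fe
  refine mul_le_mul_of_nonneg_right ?_ (by positivity)
  rw [hexp]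
  rcases le_total s1 s with hc | hc
  · have k := h.vneg_ge he hκ hκ2 hek h01 h1 h1p hc hs
    have k2 : s1 ^ (2 - κ) ≤ s ^ (2 - κ) := Real.rpow_le_rpow h1p.le hc (by linarith)
    rw [max_eq_right (by linarith)]
    have k3 : v s ^ (2 * e + 1) = (v s ^ (-e)) ^ (-(2 + 1 / e)) := by
      rw [← Real.rpow_mul hv.le]
      congr 1
      field_simp
    rw [k3]
    refine Real.rpow_le_rpow_of_nonpos ?_ k ?_
    · have : 0 ≤ aval d κ e s1 / ((d : ℝ) - 1) * (s ^ (2 - κ) - s1 ^ (2 - κ)) :=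
        mul_nonneg (div_nonneg ha (by linarith)) (by linarith)
      linarith
    · have : 0 < 1 / e := by positivity
      linarith
  · have k2 : s ^ (2 - κ) ≤ s1 ^ (2 - κ) := Real.rpow_le_rpow hs0.le hc (by linarith)
    rw [max_eq_left (by linarith)]
    simp only [mul_zero, add_zero, Real.one_rpow]
    exact Real.rpow_le_one hv.le (h.vle1 ⟨hss, hs.le⟩) (by linarith)

lemma q_le_I0 (h : Bub d e s0 g v q) (hd : 2 ≤ d) {F : ℝ → ℝ} (hF : Continuous F) {D : ℝ}
    (hD : IntegrableOn (fun x => |F x - F0 d x|) (Ioi 0))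
    (hDD : ∫ x in Ioi (0 : ℝ), |F x - F0 d x| = D)
    (hle : ∀ s, s0 ≤ s → s < g → v s ^ (2 * e + 1) * s ^ d ≤ F s) {s : ℝ} (hs : s ∈ Icc s0 g) :
    q s ≤ I0 d s + D := by
  have hc : Continuous (fun x => |F x - F0 d x|) := (hF.sub (continuous_F0 hd)).abs
  have hm := mono_of_hd (a := s0) (b := s)
    (f := fun s => (∫ x in (0 : ℝ)..s, |F x - F0 d x|) + I0 d s - q s)
    (f' := fun x => |F x - F0 d x| + F0 d x - v x ^ (2 * e + 1) * x ^ d) ?_ ?_ ?_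
      ⟨le_rfl, hs.1⟩ ⟨hs.1, le_rfl⟩ hs.1
  · have k1 : ∫ x in (0 : ℝ)..s, |F x - F0 d x| ≤ D := by
      rw [intervalIntegral.integral_of_le (h.hs0.le.trans hs.1), ← hDD]
      exact setIntegral_mono_set hD (Eventually.of_forall (fun x => abs_nonneg _))
        (Eventually.of_forall (fun x hx => hx.1))
    have k2 : 0 ≤ ∫ x in (0 : ℝ)..s0, |F x - F0 d x| :=
      intervalIntegral.integral_nonneg h.hs0.le (fun x _ => abs_nonneg _)
    have k3 := I0_nonneg hd h.hs0.le
    simp only [h.q0] at hm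
    linarith
  · refine ContinuousOn.sub (Continuous.continuousOn ?_) (h.cq.mono (Icc_subset_Icc_right hs.2))
    refine Continuous.add ?_ ?_
    · exact intervalIntegral.continuous_primitive (fun a b => hc.intervalIntegrable a b) 0
    · exact continuous_iff_continuousAt.2 (fun x => (hasDerivAt_I0 hd x).continuousAt)
  · intro x hx
    exact ((intervalIntegral.integral_hasDerivAt_right (hc.intervalIntegrable _ _)
      (hc.stronglyMeasurableAtFilter _ _) hc.continuousAt).add (hasDerivAt_I0 hd x)).sub
      (h.dq x ⟨hx.1, hx.2.trans_le hs.2⟩)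
  · intro x hx
    have := hle x hx.1.le (hx.2.trans_le hs.2)
    have := le_abs_self (F x - F0 d x)
    linarith

lemma v_ge_V0 (h : Bub d e s0 g v q) (hd : 2 ≤ d) (he : 0 ≤ e) {D : ℝ} (hD : 0 ≤ D)
    (hq : ∀ s ∈ Icc s0 g, q s ≤ I0 d s + D) {η s : ℝ} (hη : s0 ≤ η) (hs : η ≤ s) (hsg : s ≤ g) :
    V0 d s - η ^ 2 / (2 * ((d : ℝ) + 1)) - D / η ^ d * s ≤ v s := by
  have hη0 : 0 < η := h.hs0.trans_le hη
  have hm := mono_of_hd (a := η) (b := s)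
    (f := fun s => v s - V0 d s + D / η ^ d * s)
    (f' := fun x => -(q x / x ^ d) - -(I0 d x / x ^ d) + D / η ^ d * 1) ?_ ?_ ?_
      ⟨le_rfl, hs⟩ ⟨hs, le_rfl⟩ hs
  · simp only at hm
    have k1 := h.vge he ⟨hη, hs.trans hsg⟩
    have k2 := V0_le hd η
    have k3 : 0 ≤ D / η ^ d * η := by positivity
    linarith
  · have c1 := h.cv.mono (Icc_subset_Icc hη hsg)
    have c2 : ContinuousOn (V0 d) (Icc η s) := fun x hx =>
      (hasDerivAt_V0 hd (hη0.trans_le hx.1)).continuousAt.continuousWithinAt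
    fun_prop
  · intro x hx
    exact ((h.dv x ⟨hη.trans_lt hx.1, hx.2.trans_le hsg⟩).sub
      (hasDerivAt_V0 hd (hη0.trans hx.1))).add ((hasDerivAt_id x).const_mul _)
  · intro x hx
    have hx0 : 0 < x := hη0.trans hx.1
    have k := hq x ⟨hη.trans hx.1.le, hx.2.le.trans hsg⟩
    have k2 : D / x ^ d ≤ D / η ^ d := by
      have := hx.1.le
      gcongr
    have k3 : q x / x ^ d ≤ I0 d x / x ^ d + D / x ^ d := by
      rw [← add_div]
      gcongr
    linarith

end Bub

lemma Fe_zero {d : ℕ} {τ : ℝ} (hτ : 0 ≤ τ) :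
    Fe d 0 (1 / ((d : ℝ) + 1)) 0 τ = F0 d τ := by
  unfold Fe F0 B0
  have : τ ^ ((2 : ℝ) - 0) = τ ^ 2 := by
    rw [sub_zero]; exact_mod_cast Real.rpow_natCast τ 2
  rw [this, sub_zero, max_eq_right (by positivity)]
  congr 2
  · rw [div_div, mul_comm ((d : ℝ) - 1)]; ring
  · ring

lemma Fe_bound {d : ℕ} (hd : 2 ≤ d) {κ a c τ : ℝ} (hκ : 0 ≤ κ) (hκ2 : κ ≤ 1 / 2)
    (ha : 1 / (2 * ((d : ℝ) + 1)) ≤ a) (hc : c ≤ 1) (hτ : 0 < τ) :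
    |Fe d κ a c τ| ≤
      (1 / (2 * ((d : ℝ) + 1) * ((d : ℝ) - 1))) ^ (-((d : ℝ) + 1)) * (2 * (1 + τ ^ 2)⁻¹) := by
  have h2 : (2 : ℝ) ≤ d := by exact_mod_cast hd
  have hd1 : 0 < (d : ℝ) - 1 := by linarith
  set A0 := 1 / (2 * ((d : ℝ) + 1) * ((d : ℝ) - 1)) with hA0
  have hA0p : 0 < A0 := by positivity
  have hA01 : A0 ≤ 1 := by
    rw [hA0, div_le_one (by positivity)]
    nlinarith
  have hA : A0 ≤ a / ((d : ℝ) - 1) := by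
    rw [le_div_iff₀ hd1, hA0]
    refine le_trans (le_of_eq ?_) ha
    field_simp
  set M := max 1 τ with hM
  have hM1 : 1 ≤ M := le_max_left _ _
  have hMτ : τ ≤ M := le_max_right _ _
  have hM0 : 0 < M := by linarith
  have hMm : A0 * M ^ (2 - κ) ≤ 1 + a / ((d : ℝ) - 1) * max 0 (τ ^ (2 - κ) - c) := by
    have h0 : 0 ≤ max 0 (τ ^ (2 - κ) - c) := le_max_left _ _
    have k1 : A0 * max 0 (τ ^ (2 - κ) - c) ≤ a / ((d : ℝ) - 1) * max 0 (τ ^ (2 - κ) - c) := by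
      gcongr
    rcases le_total τ 1 with h | h
    · rw [hM, max_eq_left h, Real.one_rpow]
      nlinarith
    · rw [hM, max_eq_right h]
      have : τ ^ (2 - κ) - c ≤ max 0 (τ ^ (2 - κ) - c) := le_max_right _ _
      nlinarith
  have hE : 0 < 2 + ((d : ℝ) - 1) / (2 - κ) := by
    have : 0 < 2 - κ := by linarith
    positivity
  have hbpos : 0 < A0 * M ^ (2 - κ) := by positivity
  have hFn : 0 ≤ Fe d κ a c τ := by
    unfold Fe
    have := hbpos.trans_le hMm
    positivity
  rw [abs_of_nonneg hFn]
  unfold Fe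
  have s1 : (1 + a / ((d : ℝ) - 1) * max 0 (τ ^ (2 - κ) - c)) ^ (-(2 + ((d : ℝ) - 1) / (2 - κ))) ≤
      (A0 * M ^ (2 - κ)) ^ (-(2 + ((d : ℝ) - 1) / (2 - κ))) :=
    Real.rpow_le_rpow_of_nonpos hbpos hMm (by linarith)
  have s2 : (A0 * M ^ (2 - κ)) ^ (-(2 + ((d : ℝ) - 1) / (2 - κ))) =
      A0 ^ (-(2 + ((d : ℝ) - 1) / (2 - κ))) * M ^ (-((d : ℝ) + 3 - 2 * κ)) := by
    rw [Real.mul_rpow hA0p.le (by positivity), ← Real.rpow_mul hM0.le]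
    congr 2
    have : 2 - κ ≠ 0 := by linarith
    field_simp
    ring
  have s3 : A0 ^ (-(2 + ((d : ℝ) - 1) / (2 - κ))) ≤ A0 ^ (-((d : ℝ) + 1)) := by
    apply Real.rpow_le_rpow_of_exponent_ge hA0p hA01
    have : ((d : ℝ) - 1) / (2 - κ) ≤ (d : ℝ) - 1 := div_le_self hd1.le (by linarith)
    linarith
  have s4 : M ^ (-((d : ℝ) + 3 - 2 * κ)) ≤ M ^ (-((d : ℝ) + 2)) :=
    Real.rpow_le_rpow_of_exponent_le hM1 (by linarith)
  have s5 : τ ^ d ≤ M ^ d := by gcongr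
  have s6 : M ^ (-((d : ℝ) + 2)) * M ^ d = (M ^ 2)⁻¹ := by
    rw [← Real.rpow_natCast M d, ← Real.rpow_add hM0, ← Real.rpow_natCast M 2,
      ← Real.rpow_neg hM0.le]
    congr 1
    push_cast
    ring
  have s7 : (M ^ 2)⁻¹ ≤ 2 * (1 + τ ^ 2)⁻¹ := by
    rw [← div_eq_mul_inv, inv_eq_one_div, div_le_div_iff₀ (by positivity) (by positivity)]
    nlinarith
  calc _ ≤ (A0 ^ (-((d : ℝ) + 1)) * M ^ (-((d : ℝ) + 2))) * M ^ d := by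
        rw [s2] at s1
        have := s1.trans (mul_le_mul s3 s4 (by positivity) (by positivity))
        gcongr
    _ = A0 ^ (-((d : ℝ) + 1)) * (M ^ 2)⁻¹ := by rw [mul_assoc, s6]
    _ ≤ _ := by gcongr

lemma D_tendsto {ι : Type*} {l : Filter ι} [l.IsCountablyGenerated] {d : ℕ} (hd : 2 ≤ d)
    {κ a c : ι → ℝ} (hκ0 : ∀ᶠ i in l, 0 ≤ κ i) (hκ : Tendsto κ l (𝓝 0))
    (ha : Tendsto a l (𝓝 (1 / ((d : ℝ) + 1)))) (hc : Tendsto c l (𝓝 0)) :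
    (∀ᶠ i in l, IntegrableOn (fun x => |Fe d (κ i) (a i) (c i) x - F0 d x|) (Ioi 0)) ∧
    Tendsto (fun i => ∫ x in Ioi (0 : ℝ), |Fe d (κ i) (a i) (c i) x - F0 d x|) l (𝓝 0) := by
  have h2 : (2 : ℝ) ≤ d := by exact_mod_cast hd
  have hlt : 1 / (2 * ((d : ℝ) + 1)) < 1 / ((d : ℝ) + 1) := by
    apply one_div_lt_one_div_of_lt <;> linarith
  have hd1 : 0 < (d : ℝ) - 1 := by linarith
  have hev : ∀ᶠ i in l, (0 ≤ κ i ∧ κ i ≤ 1 / 2 ∧ 1 / (2 * ((d : ℝ) + 1)) ≤ a i ∧ c i ≤ 1) := by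
    filter_upwards [hκ0, hκ.eventually (ge_mem_nhds (show (0 : ℝ) < 1 / 2 by norm_num)),
      ha.eventually (le_mem_nhds hlt), hc.eventually (ge_mem_nhds (show (0 : ℝ) < 1 by norm_num))]
      with i h1 h2 h3 h4
    exact ⟨h1, h2, h3, h4⟩
  set C := (1 / (2 * ((d : ℝ) + 1) * ((d : ℝ) - 1))) ^ (-((d : ℝ) + 1)) with hC
  set bd : ℝ → ℝ := fun τ => 2 * (C * (2 * (1 + τ ^ 2)⁻¹)) with hbd
  have hbdi : Integrable bd (volume.restrict (Ioi 0)) :=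
    (((integrable_inv_one_add_sq.const_mul 2).const_mul C).const_mul 2).restrict
  have hmeas : ∀ᶠ i in l, AEStronglyMeasurable (fun x => |Fe d (κ i) (a i) (c i) x - F0 d x|)
      (volume.restrict (Ioi 0)) := by
    filter_upwards [hev] with i hi
    refine (Continuous.abs ((continuous_Fe hd (by linarith [hi.2.1]) ?_).sub
      (continuous_F0 hd))).aestronglyMeasurable
    refine le_trans ?_ hi.2.2.1
    positivity
  have hbound : ∀ᶠ i in l, ∀ᵐ x ∂(volume.restrict (Ioi (0 : ℝ))),
      ‖|Fe d (κ i) (a i) (c i) x - F0 d x|‖ ≤ bd x := by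
    filter_upwards [hev] with i hi
    refine (ae_restrict_iff' measurableSet_Ioi).2 (Eventually.of_forall fun x hx => ?_)
    have hx0 : (0 : ℝ) < x := hx
    have b1 := Fe_bound hd hi.1 hi.2.1 hi.2.2.1 hi.2.2.2 hx0
    have b2 := Fe_bound (κ := 0) (a := 1 / ((d : ℝ) + 1)) (c := 0) hd le_rfl (by norm_num)
      hlt.le zero_le_one hx0
    rw [Fe_zero hx0.le] at b2
    rw [Real.norm_eq_abs, abs_abs]
    refine (abs_sub _ _).trans ?_
    simp only [hbd]
    linarith
  constructor
  · filter_upwards [hmeas, hbound] with i h1 h2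
    exact Integrable.mono' hbdi h1 h2
  · have := tendsto_integral_filter_of_dominated_convergence (μ := volume.restrict (Ioi (0 : ℝ)))
      (l := l) (F := fun i x => |Fe d (κ i) (a i) (c i) x - F0 d x|) (f := fun _ => 0) bd
      hmeas hbound hbdi ?_
    · simpa using this
    · refine (ae_restrict_iff' measurableSet_Ioi).2 (Eventually.of_forall fun x hx => ?_)
      have hx0 : (0 : ℝ) < x := hx
      rw [← Fe_zero hx0.le]
      rw [show (0 : ℝ) = |Fe d 0 (1 / ((d : ℝ) + 1)) 0 x - Fe d 0 (1 / ((d : ℝ) + 1)) 0 x| by simp]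
      refine (Tendsto.sub ?_ (by simpa using tendsto_const_nhds)).abs
      unfold Fe
      refine Tendsto.mul_const _ ?_
      have t0 : Tendsto (fun i => 2 - κ i) l (𝓝 (2 - 0)) := hκ.const_sub 2
      have t1 : Tendsto (fun i => x ^ (2 - κ i)) l (𝓝 (x ^ ((2 : ℝ) - 0))) :=
        (tendsto_const_nhds).rpow t0 (Or.inl hx0.ne')
      have t2 : Tendsto (fun i => max 0 (x ^ (2 - κ i) - c i)) l
          (𝓝 (max 0 (x ^ ((2 : ℝ) - 0) - 0))) :=
        (tendsto_const_nhds).max (t1.sub hc)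
      refine Tendsto.rpow (((ha.div_const _).mul t2).const_add 1)
        ((Tendsto.div tendsto_const_nhds t0 (by norm_num)).const_add 2).neg (Or.inl ?_)
      have : 0 ≤ max 0 (x ^ ((2 : ℝ) - 0) - 0) := le_max_left _ _
      positivity

/-- the limiting constant -/
def L0 (d : ℕ) : ℝ := (((d : ℝ) + 1) * ((d : ℝ) - 1)) ^ (((d : ℝ) + 1) / 2) / ((d : ℝ) + 1)

lemma I0_eq {d : ℕ} (hd : 2 ≤ d) {s : ℝ} (hs : 0 < s) :
    I0 d s = (s ^ 2 / B0 d s) ^ (((d : ℝ) + 1) / 2) / ((d : ℝ) + 1) := by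
  have hB := B0_pos hd s
  unfold I0
  rw [Real.div_rpow (by positivity) hB.le, Real.rpow_neg hB.le]
  have : (s ^ 2) ^ (((d : ℝ) + 1) / 2) = s ^ (d + 1) := by
    rw [← Real.rpow_natCast s 2, ← Real.rpow_mul hs.le, ← Real.rpow_natCast s (d + 1)]
    congr 1
    push_cast
    ring
  rw [this]
  field_simp

lemma I0_le {d : ℕ} (hd : 2 ≤ d) {s : ℝ} (hs : 0 < s) : I0 d s ≤ L0 d := by
  have h2 : (2 : ℝ) ≤ d := by exact_mod_cast hd
  have hd1 : 0 < (d : ℝ) - 1 := by linarith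
  have hB := B0_pos hd s
  rw [I0_eq hd hs]
  unfold L0
  gcongr
  rw [div_le_iff₀ hB]
  unfold B0
  have : ((d : ℝ) + 1) * ((d : ℝ) - 1) * (1 + s ^ 2 / (((d : ℝ) - 1) * ((d : ℝ) + 1))) =
    ((d : ℝ) + 1) * ((d : ℝ) - 1) + s ^ 2 := by field_simp
  rw [this]
  nlinarith

lemma I0_tendsto {d : ℕ} (hd : 2 ≤ d) : Tendsto (I0 d) atTop (𝓝 (L0 d)) := by
  have h2 : (2 : ℝ) ≤ d := by exact_mod_cast hd
  have hd1 : 0 < (d : ℝ) - 1 := by linarith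
  have hinv : Tendsto (fun s : ℝ => (s ^ 2)⁻¹ + 1 / (((d : ℝ) - 1) * ((d : ℝ) + 1))) atTop
      (𝓝 (0 + 1 / (((d : ℝ) - 1) * ((d : ℝ) + 1)))) :=
    Tendsto.add_const _ (tendsto_inv_atTop_zero.comp (tendsto_pow_atTop (by norm_num)))
  have h3 := ((hinv.inv₀ (by positivity)).rpow_const (p := ((d : ℝ) + 1) / 2)
    (Or.inl (by positivity))).div_const ((d : ℝ) + 1)
  have e1 : (0 + 1 / (((d : ℝ) - 1) * ((d : ℝ) + 1)))⁻¹ = ((d : ℝ) + 1) * ((d : ℝ) - 1) := by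
    field_simp; ring
  rw [e1] at h3
  refine h3.congr' ?_
  filter_upwards [eventually_gt_atTop 0] with s hs
  rw [I0_eq hd hs]
  congr 2
  unfold B0
  field_simp

lemma I0_V0 {d : ℕ} (hd : 2 ≤ d) (s : ℝ) :
    I0 d s = 1 / ((d : ℝ) + 1) * s ^ ((d : ℝ) + 1 - 0) * V0 d s ^ (2 / ((d : ℝ) - 1) + 1) := by
  have h2 : (2 : ℝ) ≤ d := by exact_mod_cast hd
  have hd1 : 0 < (d : ℝ) - 1 := by linarith
  have hB := B0_pos hd s
  unfold I0 V0
  rw [← Real.rpow_mul hB.le]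
  have e1 : s ^ ((d : ℝ) + 1 - 0) = s ^ (d + 1) := by
    rw [sub_zero]; exact_mod_cast Real.rpow_natCast s (d + 1)
  have e2 : -(((d : ℝ) - 1) / 2) * (2 / ((d : ℝ) - 1) + 1) = -(((d : ℝ) + 1) / 2) := by
    field_simp
    ring
  rw [e1, e2]
  ring

theorem bubble_limit {ι : Type*} {l : Filter ι} [l.IsCountablyGenerated] {d : ℕ} (hd : 2 ≤ d)
    {κ e s0 g s1 : ι → ℝ} {v q : ι → ℝ → ℝ}
    (hB : ∀ᶠ i in l, Bub d (e i) (s0 i) (g i) (v i) (q i))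
    (hκ0 : ∀ᶠ i in l, 0 ≤ κ i) (hκ : Tendsto κ l (𝓝 0))
    (hek : ∀ᶠ i in l, ((d : ℝ) - 1) * e i = 2 - κ i)
    (hs1p : ∀ᶠ i in l, 0 < s1 i) (hs1 : Tendsto s1 l (𝓝 0))
    (hs01 : ∀ᶠ i in l, s0 i ≤ s1 i ^ 2)
    (hs1κ : Tendsto (fun i => s1 i ^ κ i) l (𝓝 1)) :
    Tendsto (fun i => q i (g i)) l (𝓝 (L0 d)) := by
  have h2 : (2 : ℝ) ≤ d := by exact_mod_cast hd
  have hd1 : 0 < (d : ℝ) - 1 := by linarith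
  have he : Tendsto e l (𝓝 (2 / ((d : ℝ) - 1))) := by
    have t : Tendsto (fun i => (2 - κ i) / ((d : ℝ) - 1)) l (𝓝 ((2 - 0) / ((d : ℝ) - 1))) :=
      (hκ.const_sub 2).div_const _
    rw [sub_zero] at t
    refine t.congr' ?_
    filter_upwards [hek] with i hi
    rw [← hi]
    field_simp
  have hepos : ∀ᶠ i in l, 0 < e i := he.eventually (lt_mem_nhds (by positivity))
  set a : ι → ℝ := fun i => Bub.aval d (κ i) (e i) (s1 i) with ha_def
  have ha : Tendsto a l (𝓝 (1 / ((d : ℝ) + 1))) := by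
    have t1 : Tendsto (fun i => 1 - s1 i ^ (d + 1)) l (𝓝 (1 - 0 ^ (d + 1))) :=
      (hs1.pow (d + 1)).const_sub 1
    have t2 : Tendsto (fun i => 1 - s1 i ^ 2 / (2 * ((d : ℝ) + 1))) l
        (𝓝 (1 - 0 ^ 2 / (2 * ((d : ℝ) + 1)))) :=
      ((hs1.pow 2).div_const _).const_sub 1
    have t3 := t2.rpow ((he.const_mul 2).add_const 1) (Or.inl (by norm_num))
    have t4 := ((hs1κ.mul t1).mul t3).div_const ((d : ℝ) + 1)
    simpa [ha_def, Bub.aval] using t4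
  have hapos : ∀ᶠ i in l, 0 < a i := ha.eventually (lt_mem_nhds (by positivity))
  have hs1l : ∀ᶠ i in l, s1 i < 1 := hs1.eventually (gt_mem_nhds (by norm_num))
  have hκ1 : ∀ᶠ i in l, κ i < 1 := hκ.eventually (gt_mem_nhds (by norm_num))
  set c : ι → ℝ := fun i => s1 i ^ (2 - κ i) with hc_def
  have hc : Tendsto c l (𝓝 0) := by
    refine squeeze_zero' ?_ ?_ hs1
    · filter_upwards [hs1p] with i hi
      positivity
    · filter_upwards [hs1p, hs1l, hκ1] with i h1 h2 h3
      calc c i ≤ s1 i ^ (1 : ℝ) := Real.rpow_le_rpow_of_exponent_ge h1 h2.le (by linarith)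
        _ = s1 i := Real.rpow_one _
  obtain ⟨hDi, hDt⟩ := D_tendsto hd hκ0 hκ ha hc
  set D : ι → ℝ := fun i => ∫ x in Ioi (0 : ℝ), |Fe d (κ i) (a i) (c i) x - F0 d x| with hD_def
  have hqI : ∀ᶠ i in l, ∀ s ∈ Icc (s0 i) (g i), q i s ≤ I0 d s + D i := by
    filter_upwards [hB, hκ0, hek, hs1p, hs01, hepos, hapos, hs1l, hκ1, hDi]
      with i b1 b2 b3 b4 b5 b6 b7 b8 b9 b10 s hs
    refine b1.q_le_I0 hd (continuous_Fe hd (by linarith) b7.le) b10 rfl ?_ hs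
    intro s hs hs'
    exact b1.dens_le b6 b2 (by linarith) hd b3 b5 b8 b4 b7.le hs hs'
  have hDn : ∀ i, 0 ≤ D i := fun i => integral_nonneg (fun x => abs_nonneg _)
  rw [tendsto_order]
  constructor
  · intro ℓ hℓ
    obtain ⟨S, hSℓ, hS1⟩ :=
      (((I0_tendsto hd).eventually (lt_mem_nhds hℓ)).and (eventually_gt_atTop 1)).exists
    rw [I0_V0 hd] at hSℓ
    have hV := V0_pos hd S
    have hcont : ContinuousAt (fun x : ℝ => 1 / ((d : ℝ) + 1) * S ^ ((d : ℝ) + 1 - 0) *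
        x ^ (2 / ((d : ℝ) - 1) + 1)) (V0 d S) :=
      continuousAt_const.mul (Real.continuousAt_rpow_const _ _ (Or.inl hV.ne'))
    have hx1 : ∀ᶠ x in 𝓝[<] (V0 d S), ℓ < 1 / ((d : ℝ) + 1) * S ^ ((d : ℝ) + 1 - 0) *
        x ^ (2 / ((d : ℝ) - 1) + 1) :=
      (hcont.tendsto.eventually (lt_mem_nhds hSℓ)).filter_mono nhdsWithin_le_nhds
    have hx2 : ∀ᶠ x in 𝓝[<] (V0 d S), 0 < x :=
      (lt_mem_nhds hV).filter_mono nhdsWithin_le_nhds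
    obtain ⟨x, hxℓ, hx0, hxV⟩ := (hx1.and (hx2.and self_mem_nhdsWithin)).exists
    have hxV' : x < V0 d S := hxV
    have hη1 : Tendsto (fun η : ℝ => η ^ 2 / (2 * ((d : ℝ) + 1))) (𝓝[>] 0) (𝓝 0) := by
      have : ContinuousAt (fun η : ℝ => η ^ 2 / (2 * ((d : ℝ) + 1))) 0 := by fun_prop
      have := this.tendsto
      simp only [ne_eq, OfNat.ofNat_ne_zero, not_false_eq_true, zero_pow, zero_div] at this
      exact this.mono_left nhdsWithin_le_nhds
    have hη2 : ∀ᶠ η : ℝ in 𝓝[>] 0, η < 1 :=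
      (gt_mem_nhds (by norm_num)).filter_mono nhdsWithin_le_nhds
    obtain ⟨η, hηx, hηl, hη0⟩ := ((hη1.eventually
      (gt_mem_nhds (show 0 < (V0 d S - x) / 2 by linarith))).and
      (hη2.and self_mem_nhdsWithin)).exists
    have hη0' : 0 < η := hη0
    have hD1 : ∀ᶠ i in l, D i / η ^ d * S < (V0 d S - x) / 2 := by
      have t : Tendsto (fun i => D i / η ^ d * S) l (𝓝 (0 / η ^ d * S)) :=
        (hDt.div_const _).mul_const _
      rw [zero_div, zero_mul] at t
      exact t.eventually (gt_mem_nhds (by linarith))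
    have hs0η : ∀ᶠ i in l, s0 i ≤ η := by
      filter_upwards [hs01, hs1.eventually (gt_mem_nhds hη0'), hs1p, hs1l] with i h1 h2 h3 h4
      nlinarith
    have hlim : Tendsto (fun i => a i * S ^ ((d : ℝ) + 1 - κ i) * x ^ (e i + 1)) l
        (𝓝 (1 / ((d : ℝ) + 1) * S ^ ((d : ℝ) + 1 - 0) * x ^ (2 / ((d : ℝ) - 1) + 1))) :=
      (ha.mul ((tendsto_const_nhds).rpow (hκ.const_sub _) (Or.inl (by linarith)))).mul
        ((tendsto_const_nhds).rpow (he.add_const 1) (Or.inl hx0.ne'))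
    filter_upwards [hB, hκ0, hek, hs1p, hs01, hepos, hapos, hs1l, hqI, hD1, hs0η,
      hlim.eventually (lt_mem_nhds hxℓ)]
      with i b1 b2 b3 b4 b5 b6 b7 b8 b9 b10 b11 b12
    have hηg : η < g i := b1.s1_lt b6 hηl
    have hSg : S < g i := by
      by_contra hcon
      push Not at hcon
      have k := b1.v_ge_V0 hd b6.le (hDn i) b9 b11 hηg.le le_rfl
      rw [b1.v1] at k
      have k2 := V0_anti hd (hη0'.trans hηg).le hcon
      have k3 : D i / η ^ d * g i ≤ D i / η ^ d * S := by
        have := hDn i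
        gcongr
      linarith
    have hvS : x ≤ v i S := by
      have k := b1.v_ge_V0 hd b6.le (hDn i) b9 b11 (by linarith) hSg.le
      linarith
    have k4 := b1.qlow b6 b2 b3 b5 b8 b4 (by linarith) hSg
    have k5 : q i S ≤ q i (g i) := b1.qmono ⟨by linarith, hSg.le⟩ ⟨b1.lt.le, le_rfl⟩ hSg.le
    calc ℓ < _ := b12
      _ ≤ a i * S ^ ((d : ℝ) + 1 - κ i) * v i S ^ (e i + 1) := by gcongr
      _ ≤ _ := k4.trans k5
  · intro ℓ hℓ
    filter_upwards [hqI, hB, hDt.eventually (gt_mem_nhds (show 0 < ℓ - L0 d by linarith))]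
      with i h1 h2 h3
    have k1 := h1 (g i) ⟨h2.lt.le, le_rfl⟩
    have k2 := I0_le hd (h2.hs0.trans h2.lt)
    have : D i < ℓ - L0 d := h3
    linarith

/-- radial solution in first order form; `2 e = p - 1`. -/
structure Rad (d : ℕ) (e : ℝ) (u U : ℝ → ℝ) : Prop where
  cu : ContinuousOn u (Icc 0 1)
  cU : ContinuousOn U (Icc 0 1)
  du : ∀ r ∈ Ioo (0 : ℝ) 1, HasDerivAt u (U r) r
  dU : ∀ r ∈ Ioo (0 : ℝ) 1, HasDerivAt U (-((d : ℝ) / r * U r) - |u r| ^ (2 * e) * u r) r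

/-- Emden-Fowler energy -/
def HH (e θ α : ℝ) (u U : ℝ → ℝ) (r : ℝ) : ℝ :=
  r ^ (2 * θ) * ((r * U r) ^ 2 / 2 + θ * u r * (r * U r) + θ * α * u r ^ 2 / 2
    + r ^ 2 * |u r| ^ (2 * e + 2) / (2 * e + 2))

namespace Rad
variable {d : ℕ} {e θ α : ℝ} {u U : ℝ → ℝ}

lemma neg (h : Rad d e u U) : Rad d e (fun r => - u r) (fun r => - U r) where
  cu := h.cu.neg
  cU := h.cU.neg
  du := fun r hr => (h.du r hr).neg
  dU := fun r hr => by
    refine HasDerivAt.congr_deriv (h.dU r hr).neg ?_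
    rw [abs_neg]; ring

lemma HH_neg (e θ α : ℝ) (u U : ℝ → ℝ) (r : ℝ) :
    HH e θ α (fun r => - u r) (fun r => - U r) r = HH e θ α u U r := by
  unfold HH
  rw [abs_neg]; ring

lemma absrpow {e : ℝ} (he : 0 < e) (x : ℝ) : |x| ^ (2 * e + 2) = |x| ^ (2 * e) * x ^ 2 := by
  rw [Real.rpow_add' (abs_nonneg _) (by positivity)]
  congr 1
  rw [← sq_abs x]
  exact_mod_cast Real.rpow_natCast |x| 2

lemma contH (h : Rad d e u U) (he : 0 < e) (hθ : 0 < θ) :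
    ContinuousOn (HH e θ α u U) (Icc 0 1) := by
  have c1 := h.cu
  have c2 := h.cU
  have c3 : ContinuousOn (fun r => |u r| ^ (2 * e + 2)) (Icc 0 1) :=
    c1.abs.rpow_const (fun x _ => Or.inr (by positivity))
  have c4 : ContinuousOn (fun r : ℝ => r ^ (2 * θ)) (Icc 0 1) :=
    continuousOn_id.rpow_const (fun x _ => Or.inr (by positivity))
  unfold HH
  fun_prop

lemma derivH (h : Rad d e u U) (he : 0 < e) (hθ : θ * e = 1) (hα : α = 2 * θ - ((d : ℝ) - 1))
    {r : ℝ} (hr : r ∈ Ioo (0 : ℝ) 1) :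
    HasDerivAt (HH e θ α u U) (α * (r ^ θ * (θ * u r + r * U r)) ^ 2 / r) r := by
  have hr0 := hr.1
  have a1 := h.du r hr
  have a2 := h.dU r hr
  have a3 := (hasDerivAt_id r).mul a2
  have a4 : HasDerivAt (fun r => |u r| ^ (2 * e + 2))
      ((2 * e + 2) * |u r| ^ (2 * e + 2 - 2) * u r * U r) r :=
    (hasDerivAt_abs_rpow (u r) (by linarith : 1 < 2 * e + 2)).comp r a1
  have a5 := (Real.hasDerivAt_rpow_const (p := 2 * θ) (Or.inl hr0.ne')).mul
    (((((a3.pow 2).div_const 2).add ((a1.const_mul θ).mul a3)).add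
      (((a1.pow 2).const_mul (θ * α)).div_const 2)).add
      ((((hasDerivAt_pow 2 r).mul a4)).div_const (2 * e + 2)))
  refine HasDerivAt.congr_deriv a5 ?_
  have r0 : 2 * e + 2 - 2 = 2 * e := by ring
  have r1 : r ^ (2 * θ) = r ^ θ * r ^ θ := by rw [← Real.rpow_add hr0]; ring_nf
  have r2 : r ^ (2 * θ - 1) = r ^ θ * r ^ θ / r := by rw [Real.rpow_sub_one hr0.ne', r1]
  have hθe : θ = 1 / e := by field_simp; linarith
  simp only [Pi.mul_apply, Pi.pow_apply, Pi.add_apply, id, absrpow he, r0, r1, r2]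
  rw [hα]
  generalize r ^ θ = X
  generalize |u r| ^ (2 * e) = A
  rw [hθe]
  have : e + 1 ≠ 0 := by positivity
  have : 2 * e + 2 ≠ 0 := by positivity
  push_cast
  field_simp
  ring

lemma H_zero (hθ : 0 < θ) : HH e θ α u U 0 = 0 := by
  unfold HH
  rw [Real.zero_rpow (by positivity)]; ring

lemma Hmono (h : Rad d e u U) (he : 0 < e) (hθ : θ * e = 1) (hα : α = 2 * θ - ((d : ℝ) - 1))
    (hα0 : 0 ≤ α) (hθ0 : 0 < θ) : MonotoneOn (HH e θ α u U) (Icc 0 1) := by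
  refine mono_of_hd (h.contH he hθ0) (fun r hr => h.derivH he hθ hα hr) ?_
  intro r hr
  have := hr.1
  positivity

lemma Hnonneg (h : Rad d e u U) (he : 0 < e) (hθ : θ * e = 1) (hα : α = 2 * θ - ((d : ℝ) - 1))
    (hα0 : 0 ≤ α) (hθ0 : 0 < θ) {r : ℝ} (hr : r ∈ Icc (0 : ℝ) 1) : 0 ≤ HH e θ α u U r := by
  have := h.Hmono he hθ hα hα0 hθ0 ⟨le_rfl, zero_le_one⟩ hr hr.1
  rwa [H_zero hθ0] at this

/-- the logarithmic slope is (weightedly) decreasing -/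
lemma zeta_anti (h : Rad d e u U) (he : 0 < e) (hθ : θ * e = 1) (hα : α = 2 * θ - ((d : ℝ) - 1))
    (hα0 : 0 ≤ α) (hθ0 : 0 < θ) {s t : ℝ} (hs0 : 0 < s) (hst : s ≤ t) (ht : t < 1)
    (hu : ∀ x ∈ Icc s t, 0 < u x) :
    t ^ (-α) * (θ + t * U t / u t) ≤ s ^ (-α) * (θ + s * U s / u s) := by
  have hm := mono_of_hd (a := s) (b := t) (f := fun t => -(t ^ (-α) * (θ + t * U t / u t)))
    (f' := fun r => r ^ (-α) / (r * u r ^ 2) * ((r * U r) ^ 2 + 2 * θ * u r * (r * U r) +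
      θ * α * u r ^ 2 + r ^ 2 * |u r| ^ (2 * e + 2))) ?_ ?_ ?_
      ⟨le_rfl, hst⟩ ⟨hst, le_rfl⟩ hst
  · simpa using hm
  · have c1 := h.cu.mono (Icc_subset_Icc hs0.le ht.le)
    have c2 := h.cU.mono (Icc_subset_Icc hs0.le ht.le)
    have c4 : ContinuousOn (fun r : ℝ => r ^ (-α)) (Icc s t) :=
      continuousOn_id.rpow_const (fun x hx => Or.inl (hs0.trans_le hx.1).ne')
    have c5 : ∀ x ∈ Icc s t, u x ≠ 0 := fun x hx => (hu x hx).ne'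
    fun_prop (disch := assumption)
  · intro r hr
    have hr0 : 0 < r := hs0.trans hr.1
    have hr' : r ∈ Ioo (0 : ℝ) 1 := ⟨hr0, hr.2.trans ht⟩
    have hur := hu r ⟨hr.1.le, hr.2.le⟩
    have a1 := h.du r hr'
    have a2 := h.dU r hr'
    have a5 := ((Real.hasDerivAt_rpow_const (p := -α) (Or.inl hr0.ne')).mul
      ((((hasDerivAt_id r).mul a2).div a1 hur.ne').const_add θ)).neg
    refine HasDerivAt.congr_deriv a5 ?_
    have r2 : r ^ (-α - 1) = r ^ (-α) / r := Real.rpow_sub_one hr0.ne' _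
    simp only [Pi.mul_apply, Pi.div_apply, id, absrpow he, r2]
    generalize r ^ (-α) = X
    generalize |u r| ^ (2 * e) = A
    rw [hα]
    field_simp
    ring
  · intro r hr
    have hr0 : 0 < r := hs0.trans hr.1
    have hur := hu r ⟨hr.1.le, hr.2.le⟩
    have hH := h.Hnonneg he hθ hα hα0 hθ0 (r := r) ⟨hr0.le, hr.2.le.trans ht.le⟩
    unfold HH at hH
    have hp : 0 < r ^ (2 * θ) := by positivity
    have hH' := nonneg_of_mul_nonneg_right hH hp
    refine mul_nonneg (by positivity) ?_
    have k1 : r ^ 2 * |u r| ^ (2 * e + 2) / (2 * e + 2) ≤ r ^ 2 * |u r| ^ (2 * e + 2) / 2 := by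
      gcongr
      linarith
    linarith

/-- energy bound controls the Emden-Fowler variables -/
lemma yY_bound (hd : 2 ≤ d) (he : 0 < e) (hed : 1 ≤ e * d) (he2 : e ≤ 2) (hθ : θ * e = 1)
    (hα : α = 2 * θ - ((d : ℝ) - 1)) {K : ℝ}
    (hK : K = (2 + (d : ℝ)) * (6 * (1 + (d : ℝ) ^ 2)) ^ (d : ℝ))
    {r : ℝ} (hr : 0 < r) (hH : HH e θ α u U r ≤ 1) :
    |r ^ θ * u r| ≤ K ∧ |r ^ θ * (θ * u r + r * U r)| ≤ K := by
  have h2 : (2 : ℝ) ≤ d := by exact_mod_cast hd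
  set y := r ^ θ * u r with hy
  set Y := r ^ θ * (θ * u r + r * U r) with hY
  have hyp : |y| ^ (2 * e + 2) = r ^ (2 * θ) * (r ^ 2 * |u r| ^ (2 * e + 2)) := by
    rw [hy, abs_mul, Real.mul_rpow (abs_nonneg _) (abs_nonneg _), abs_of_pos (by positivity),
      ← Real.rpow_mul hr.le, ← mul_assoc]
    congr 1
    rw [← Real.rpow_natCast r 2, ← Real.rpow_add hr]
    congr 1
    push_cast
    linarith
  have hHe : HH e θ α u U r = Y ^ 2 / 2 - θ * ((d : ℝ) - 1 - θ) * y ^ 2 / 2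
      + |y| ^ (2 * e + 2) / (2 * e + 2) := by
    rw [hyp]
    unfold HH
    rw [hy, hY, hα]
    have r1 : r ^ (2 * θ) = r ^ θ * r ^ θ := by rw [← Real.rpow_add hr]; ring_nf
    rw [r1]
    ring
  rw [hHe] at hH
  have hb : θ * ((d : ℝ) - 1 - θ) ≤ (d : ℝ) ^ 2 := by nlinarith [sq_nonneg (2 * θ - (d - 1))]
  set C := 6 * (1 + (d : ℝ) ^ 2) with hC
  have hC1 : 1 ≤ C := by nlinarith
  have hK0 : 1 ≤ C ^ (d : ℝ) := Real.one_le_rpow hC1 (by linarith)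
  have hby : θ * ((d : ℝ) - 1 - θ) * y ^ 2 ≤ (d : ℝ) ^ 2 * y ^ 2 := by gcongr
  have hyK0 : |y| ≤ C ^ (d : ℝ) := by
    by_contra hcon
    push Not at hcon
    have hy1 : 1 < |y| := lt_of_le_of_lt hK0 hcon
    have k1 : |y| ^ (2 * e) * y ^ 2 / (2 * e + 2) ≤ 1 + (d : ℝ) ^ 2 * y ^ 2 / 2 := by
      rw [← absrpow he]
      nlinarith [sq_nonneg Y]
    have hy2 : 1 < y ^ 2 := by rw [← sq_abs]; nlinarith
    rw [div_le_iff₀ (by positivity)] at k1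
    have k2 : |y| ^ (2 * e) * y ^ 2 < C * y ^ 2 := by
      have : (1 + (d : ℝ) ^ 2 * y ^ 2 / 2) * (2 * e + 2) ≤ (1 + (d : ℝ) ^ 2 * y ^ 2 / 2) * 6 := by
        gcongr
        linarith
      nlinarith
    have k3 : |y| ^ (2 * e) < C := lt_of_mul_lt_mul_right k2 (by positivity)
    have k4 : C ≤ |y| ^ (2 * e) := by
      calc C = C ^ (1 : ℝ) := (Real.rpow_one C).symm
        _ ≤ C ^ ((d : ℝ) * (2 * e)) := Real.rpow_le_rpow_of_exponent_le hC1 (by linarith)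
        _ = (C ^ (d : ℝ)) ^ (2 * e) := Real.rpow_mul (by linarith) _ _
        _ ≤ _ := Real.rpow_le_rpow (by positivity) hcon.le (by positivity)
    linarith
  constructor
  · refine hyK0.trans ?_
    rw [hK]
    nlinarith
  · apply abs_le_of_sq_le_sq _ (by rw [hK]; positivity)
    have k1 : Y ^ 2 ≤ 2 + (d : ℝ) ^ 2 * y ^ 2 := by
      have : 0 ≤ |y| ^ (2 * e + 2) / (2 * e + 2) := by positivity
      linarith
    have k2 : y ^ 2 ≤ (C ^ (d : ℝ)) ^ 2 := by
      rw [← sq_abs]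
      gcongr
    have k3 : 1 ≤ (C ^ (d : ℝ)) ^ 2 := one_le_pow₀ hK0
    rw [hK]
    nlinarith

end Rad

namespace Rad
variable {d : ℕ} {e θ α : ℝ} {u U : ℝ → ℝ}

/-- energy increment over (part of) a positive nodal region -/
lemma stepPos (h : Rad d e u U) (hd : 2 ≤ d) (he : 0 < e) (hed : 1 ≤ e * d) (he2 : e ≤ 2)
    (hθ : θ * e = 1) (hα : α = 2 * θ - ((d : ℝ) - 1)) (hα0 : 0 ≤ α) (hθ0 : 0 < θ) {K : ℝ}
    (hK : K = (2 + (d : ℝ)) * (6 * (1 + (d : ℝ) ^ 2)) ^ (d : ℝ))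
    {x r : ℝ} (hx : 0 ≤ x) (hxr : x ≤ r) (hr : r ≤ 1) (hu : ∀ t ∈ Ioo x r, 0 < u t)
    (hH : HH e θ α u U r ≤ 1) : HH e θ α u U r ≤ HH e θ α u U x + 2 * α * K ^ 2 := by
  have h2 : (2 : ℝ) ≤ d := by exact_mod_cast hd
  have hK0 : 0 ≤ K := by rw [hK]; positivity
  rcases eq_or_lt_of_le hxr with rfl | hlt
  · have : 0 ≤ 2 * α * K ^ 2 := by positivity
    linarith
  set y : ℝ → ℝ := fun r => r ^ θ * u r with hy
  set Y : ℝ → ℝ := fun r => r ^ θ * (θ * u r + r * U r) with hY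
  have hbd : ∀ t ∈ Ioc x r, |y t| ≤ K ∧ |Y t| ≤ K := by
    intro t ht
    refine yY_bound hd he hed he2 hθ hα hK (hx.trans_lt ht.1) (le_trans ?_ hH)
    exact h.Hmono he hθ hα hα0 hθ0 ⟨hx.trans ht.1.le, ht.2.trans hr⟩ ⟨hx.trans hxr, hr⟩ ht.2
  have cy : ContinuousOn y (Icc 0 1) :=
    (continuousOn_id.rpow_const (fun x _ => Or.inr hθ0.le)).mul h.cu
  have hysub : Icc x r ⊆ Icc 0 1 := Icc_subset_Icc hx hr
  have hyn : ∀ t ∈ Icc x r, 0 ≤ y t ∧ y t ≤ K := by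
    have hcl : closure (Ioo x r) = Icc x r := closure_Ioo hlt.ne
    have hm : MapsTo y (closure (Ioo x r)) (closure (Icc 0 K)) := by
      refine MapsTo.closure_of_continuousOn ?_ ?_
      · intro t ht
        have ht0 : 0 < t := hx.trans_lt ht.1
        have := hu t ht
        exact ⟨by simp only [hy]; positivity, (le_abs_self _).trans (hbd t ⟨ht.1, ht.2.le⟩).1⟩
      · rw [hcl]; exact cy.mono hysub
    rw [hcl, isClosed_Icc.closure_eq] at hm
    exact fun t ht => hm ht
  have dy : ∀ t ∈ Ioo x r, HasDerivAt y (Y t / t) t := by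
    intro t ht
    have ht0 : 0 < t := hx.trans_lt ht.1
    refine HasDerivAt.congr_deriv ((Real.hasDerivAt_rpow_const (p := θ) (Or.inl ht0.ne')).mul
      (h.du t ⟨ht0, ht.2.trans_le hr⟩)) ?_
    rw [Real.rpow_sub_one ht0.ne']
    simp only [hY]
    field_simp
  have dH : ∀ t ∈ Ioo x r, HasDerivAt (HH e θ α u U) (α * Y t ^ 2 / t) t := by
    intro t ht
    exact h.derivH he hθ hα ⟨hx.trans_lt ht.1, ht.2.trans_le hr⟩
  have cH : ContinuousOn (HH e θ α u U) (Icc 0 1) := h.contH he hθ0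
  have hsign : ∀ s ∈ Ioo x r, ∀ t ∈ Ioo x r, s ≤ t → 0 < Y t → 0 < Y s := by
    intro s hs t ht hst hYt
    have hs0 : 0 < s := hx.trans_lt hs.1
    have ht0 : 0 < t := hx.trans_lt ht.1
    have hus := hu s hs
    have hut := hu t ht
    have hz := h.zeta_anti he hθ hα hα0 hθ0 hs0 hst (ht.2.trans_le hr)
      (fun w hw => hu w ⟨hs.1.trans_le hw.1, hw.2.trans_lt ht.2⟩)
    have e1 : θ * u t + t * U t = (θ + t * U t / u t) * u t := by field_simp
    have e2 : θ * u s + s * U s = (θ + s * U s / u s) * u s := by field_simp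
    simp only [hY] at hYt ⊢
    rw [e1] at hYt
    rw [e2]
    have k1 : 0 < (θ + t * U t / u t) :=
      pos_of_mul_pos_left (pos_of_mul_pos_right hYt (by positivity)) hut.le
    have k2 : 0 < s ^ (-α) * (θ + s * U s / u s) := lt_of_lt_of_le (by positivity) hz
    have k3 : 0 < θ + s * U s / u s := pos_of_mul_pos_right k2 (by positivity)
    positivity
  obtain ⟨T, hT, hT1, hT2⟩ : ∃ T ∈ Icc x r, (∀ t ∈ Ioo x T, 0 ≤ Y t) ∧
      (∀ t ∈ Ioo T r, Y t ≤ 0) := by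
    set S := {t | t ∈ Ioo x r ∧ 0 < Y t} with hS
    rcases S.eq_empty_or_nonempty with hE | hN
    · refine ⟨x, ⟨le_rfl, hxr⟩, fun t ht => absurd (ht.1.trans ht.2) (lt_irrefl _), ?_⟩
      intro t ht
      by_contra hcon
      push Not at hcon
      have : t ∈ S := ⟨ht, hcon⟩
      rw [hE] at this
      exact this
    · have hbdd : BddAbove S := ⟨r, fun t ht => ht.1.2.le⟩
      obtain ⟨t0, ht0⟩ := hN
      refine ⟨sSup S, ⟨ht0.1.1.le.trans (le_csSup hbdd ht0), csSup_le ⟨t0, ht0⟩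
        (fun t ht => ht.1.2.le)⟩, ?_, ?_⟩
      · intro t ht
        obtain ⟨t', ht', htt⟩ := exists_lt_of_lt_csSup ⟨t0, ht0⟩ ht.2
        exact (hsign t ⟨ht.1, htt.trans ht'.1.2⟩ t' ht'.1 htt.le ht'.2).le
      · intro t ht
        by_contra hcon
        push Not at hcon
        have : t ∈ S := ⟨⟨ht0.1.1.trans_le ((le_csSup hbdd ht0).trans ht.1.le), ht.2⟩, hcon⟩
        exact absurd (le_csSup hbdd this) (not_le.2 ht.1)
  have m1 := mono_of_hd (a := x) (b := T) (f := fun t => α * K * y t - HH e θ α u U t)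
    (f' := fun t => α * K * (Y t / t) - α * Y t ^ 2 / t)
    (((continuousOn_const (c := α * K)).mul (cy.mono ((Icc_subset_Icc_right hT.2).trans hysub))).sub
      (cH.mono ((Icc_subset_Icc_right hT.2).trans hysub)))
    (fun t ht => ((dy t ⟨ht.1, ht.2.trans_le hT.2⟩).const_mul _).sub
      (dH t ⟨ht.1, ht.2.trans_le hT.2⟩)) (by
      intro t ht
      have ht0 : 0 < t := hx.trans_lt ht.1
      have k1 := hT1 t ht
      have k2 := (le_abs_self _).trans (hbd t ⟨ht.1, ht.2.le.trans hT.2⟩).2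
      have : α * K * (Y t / t) - α * Y t ^ 2 / t = α * Y t * (K - Y t) / t := by ring
      rw [this]
      exact div_nonneg (mul_nonneg (by positivity) (by linarith)) ht0.le)
    ⟨le_rfl, hT.1⟩ ⟨hT.1, le_rfl⟩ hT.1
  have m2 := mono_of_hd (a := T) (b := r) (f := fun t => (-(α * K)) * y t - HH e θ α u U t)
    (f' := fun t => (-(α * K)) * (Y t / t) - α * Y t ^ 2 / t)
    (((continuousOn_const (c := -(α * K))).mul (cy.mono ((Icc_subset_Icc_left hT.1).trans hysub))).sub
      (cH.mono ((Icc_subset_Icc_left hT.1).trans hysub)))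
    (fun t ht => ((dy t ⟨hT.1.trans_lt ht.1, ht.2⟩).const_mul _).sub
      (dH t ⟨hT.1.trans_lt ht.1, ht.2⟩)) (by
      intro t ht
      have ht0 : 0 < t := hx.trans_lt (hT.1.trans_lt ht.1)
      have k1 := hT2 t ht
      have k2 := (neg_abs_le (Y t))
      have k3 := (hbd t ⟨hT.1.trans_lt ht.1, ht.2.le⟩).2
      have : (-(α * K)) * (Y t / t) - α * Y t ^ 2 / t = α * (-Y t) * (K + Y t) / t := by ring
      rw [this]
      exact div_nonneg (mul_nonneg (mul_nonneg hα0 (by linarith)) (by linarith)) ht0.le)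
    ⟨le_rfl, hT.2⟩ ⟨hT.2, le_rfl⟩ hT.2
  simp only at m1 m2
  have y1 := hyn x ⟨le_rfl, hxr⟩
  have y2 := hyn T hT
  have y3 := hyn r ⟨hxr, le_rfl⟩
  have hαK : 0 ≤ α * K := by positivity
  nlinarith [mul_nonneg hαK y1.1, mul_nonneg hαK y3.1, mul_nonneg hαK (sub_nonneg.2 y2.2)]

lemma step (h : Rad d e u U) (hd : 2 ≤ d) (he : 0 < e) (hed : 1 ≤ e * d) (he2 : e ≤ 2)
    (hθ : θ * e = 1) (hα : α = 2 * θ - ((d : ℝ) - 1)) (hα0 : 0 ≤ α) (hθ0 : 0 < θ) {K : ℝ}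
    (hK : K = (2 + (d : ℝ)) * (6 * (1 + (d : ℝ) ^ 2)) ^ (d : ℝ))
    {x r : ℝ} (hx : 0 ≤ x) (hxr : x ≤ r) (hr : r ≤ 1) (hu : ∀ t ∈ Ioo x r, u t ≠ 0)
    (hH : HH e θ α u U r ≤ 1) : HH e θ α u U r ≤ HH e θ α u U x + 2 * α * K ^ 2 := by
  have hcase : (∀ t ∈ Ioo x r, 0 < u t) ∨ (∀ t ∈ Ioo x r, 0 < - u t) := by
    by_contra hcon
    push Not at hcon
    obtain ⟨⟨a, ha, ha'⟩, b, hb, hb'⟩ := hcon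
    have hc : ContinuousOn u (Ioo x r) :=
      h.cu.mono (fun t ht => ⟨hx.trans ht.1.le, ht.2.le.trans hr⟩)
    have := (isPreconnected_Ioo (a := x) (b := r)).intermediate_value ha hb hc
      (⟨ha', by linarith⟩ : (0 : ℝ) ∈ Icc (u a) (u b))
    obtain ⟨c, hc, hc0⟩ := this
    exact hu c hc hc0
  rcases hcase with hc | hc
  · exact h.stepPos hd he hed he2 hθ hα hα0 hθ0 hK hx hxr hr hc hH
  · have := h.neg.stepPos hd he hed he2 hθ hα hα0 hθ0 hK hx hxr hr hc (by rwa [HH_neg])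
    rwa [HH_neg, HH_neg] at this

lemma energy (h : Rad d e u U) (hd : 2 ≤ d) (he : 0 < e) (hed : 1 ≤ e * d) (he2 : e ≤ 2)
    (hθ : θ * e = 1) (hα : α = 2 * θ - ((d : ℝ) - 1)) (hα0 : 0 ≤ α) (hθ0 : 0 < θ) {K : ℝ}
    (hK : K = (2 + (d : ℝ)) * (6 * (1 + (d : ℝ) ^ 2)) ^ (d : ℝ))
    (z : ℕ → ℝ) (hz0 : z 0 = 0) (m : ℕ) (hzm : z m = 1) (hz : ∀ j < m, z j ≤ z (j + 1))
    (hu : ∀ j < m, ∀ t ∈ Ioo (z j) (z (j + 1)), u t ≠ 0) (hsmall : m * (2 * α * K ^ 2) < 1) :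
    HH e θ α u U 1 ≤ m * (2 * α * K ^ 2) := by
  have hmono := h.Hmono he hθ hα hα0 hθ0
  have hzn : ∀ j, j ≤ m → 0 ≤ z j := by
    intro j
    induction j with
    | zero => intro _; rw [hz0]
    | succ j ih => intro hj; exact (ih (by omega)).trans (hz j (by omega))
  have hz1 : ∀ k j, j + k = m → z j ≤ 1 := by
    intro k
    induction k with
    | zero => intro j hj; rw [← hzm, ← hj]; simp
    | succ k ih => intro j hj; exact (hz j (by omega)).trans (ih (j + 1) (by omega))
  have key : ∀ j, j ≤ m → ∀ r, 0 ≤ r → r ≤ z j → HH e θ α u U r ≤ 1 →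
      HH e θ α u U r ≤ j * (2 * α * K ^ 2) := by
    intro j
    induction j with
    | zero =>
      intro _ r hr hrz _
      rw [hz0] at hrz
      have : r = 0 := le_antisymm hrz hr
      rw [this, H_zero hθ0]; simp
    | succ j ih =>
      intro hj r hr hrz hH
      have hp : 0 ≤ 2 * α * K ^ 2 := by positivity
      have hr1 : r ≤ 1 := hrz.trans (hz1 (m - (j + 1)) (j + 1) (by omega))
      push_cast
      rcases le_total r (z j) with hc | hc
      · have := ih (by omega) r hr hc hH
        linarith
      · have hzj := hzn j (by omega)
        have k1 := h.step hd he hed he2 hθ hα hα0 hθ0 hK hzj hc hr1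
          (fun t ht => hu j (by omega) t ⟨ht.1, ht.2.trans_le hrz⟩) hH
        have k2 := ih (by omega) (z j) hzj le_rfl
          ((hmono ⟨hzj, hc.trans hr1⟩ ⟨hr, hr1⟩ hc).trans hH)
        linarith
  refine key m le_rfl 1 zero_le_one hzm.ge ?_
  by_contra hcon
  push Not at hcon
  have hcH : ContinuousOn (HH e θ α u U) (Icc 0 1) := h.contH he hθ0
  have := intermediate_value_Icc zero_le_one hcH
    (⟨by rw [H_zero hθ0]; exact zero_le_one, hcon.le⟩ : (1 : ℝ) ∈ Icc _ _)
  obtain ⟨r, hr, hr1⟩ := this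
  have := key m le_rfl r hr.1 (by rw [hzm]; exact hr.2) hr1.le
  linarith

/-- at a critical point the rescaled radius is controlled by the energy -/
lemma crit (h : Rad d e u U) (he : 0 < e) (he2 : e ≤ 2)
    (hθ : θ * e = 1) (hα : α = 2 * θ - ((d : ℝ) - 1)) (hα0 : 0 ≤ α) (hθ0 : 0 < θ)
    {δ : ℝ} (hδ0 : 0 < δ) (hδ1 : δ ≤ 1) (hU : U δ = 0) {E : ℝ} (hE : HH e θ α u U 1 ≤ E) :
    (|u δ| ^ e * δ) ^ (2 * θ + 2) ≤ 6 * E := by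
  have h1 := (h.Hmono he hθ hα hα0 hθ0 ⟨hδ0.le, hδ1⟩ ⟨zero_le_one, le_rfl⟩ hδ1).trans hE
  unfold HH at h1
  rw [hU] at h1
  have h2 : (|u δ| ^ e * δ) ^ (2 * θ + 2) = δ ^ (2 * θ) * (δ ^ 2 * |u δ| ^ (2 * e + 2)) := by
    rw [Real.mul_rpow (by positivity) hδ0.le, ← Real.rpow_mul (abs_nonneg _),
      Real.rpow_add hδ0]
    have : e * (2 * θ + 2) = 2 * e + 2 := by linarith
    rw [this]
    have : δ ^ (2 : ℝ) = δ ^ 2 := by exact_mod_cast Real.rpow_natCast δ 2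
    rw [this]
    ring
  rw [h2]
  have h3 : 0 ≤ δ ^ (2 * θ) := by positivity
  have h4 : 0 ≤ δ ^ 2 * |u δ| ^ (2 * e + 2) := by positivity
  have h5 : δ ^ 2 * |u δ| ^ (2 * e + 2) / 6 ≤ δ ^ 2 * |u δ| ^ (2 * e + 2) / (2 * e + 2) := by
    apply div_le_div_of_nonneg_left h4 (by positivity) (by linarith)
  have h6 : 0 ≤ θ * α * u δ ^ 2 / 2 := by positivity
  have h7 : δ ^ (2 * θ) * (δ ^ 2 * |u δ| ^ (2 * e + 2) / 6) ≤ E := by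
    refine le_trans ?_ h1
    gcongr
    simp only [mul_zero]
    linarith
  linarith

end Rad

lemma rad_of {n : ℕ} (hn : 3 ≤ n) {p e : ℝ} {u : ℝ → ℝ} (hs : IsRadialSolution n p u)
    (he : p - 1 = 2 * e) : Rad (n - 1) e u (derivWithin u (Icc 0 1)) := by
  obtain ⟨hC, -, hode⟩ := hs
  have hun : UniqueDiffOn ℝ (Icc (0 : ℝ) 1) := uniqueDiffOn_Icc zero_lt_one
  have hd1 : ∀ r ∈ Ioo (0 : ℝ) 1, HasDerivAt u (derivWithin u (Icc 0 1) r) r := by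
    intro r hr
    exact ((hC.differentiableOn (by norm_num)) r ⟨hr.1.le, hr.2.le⟩).hasDerivWithinAt.hasDerivAt
      (Icc_mem_nhds hr.1 hr.2)
  have hU : ContDiffOn ℝ 1 (derivWithin u (Icc 0 1)) (Icc 0 1) :=
    hC.derivWithin hun (by norm_num)
  refine ⟨hC.continuousOn, hU.continuousOn, hd1, ?_⟩
  intro r hr
  have hUd : HasDerivAt (derivWithin u (Icc 0 1)) (deriv (derivWithin u (Icc 0 1)) r) r :=
    (((hU.differentiableOn (by norm_num)) r ⟨hr.1.le, hr.2.le⟩).differentiableAt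
      (Icc_mem_nhds hr.1 hr.2)).hasDerivAt
  have hpr := (hasDerivAt_pow (n - 1) r).mul hUd
  have heq : (fun s => s ^ (n - 1) * deriv u s) =ᶠ[𝓝 r]
      (fun s => s ^ (n - 1)) * derivWithin u (Icc 0 1) := by
    filter_upwards [Ioo_mem_nhds hr.1 hr.2] with s hs
    simp only [Pi.mul_apply]
    rw [(hd1 s hs).deriv]
  have h1 := hode r ⟨hr.1, hr.2.le⟩
  rw [heq.deriv_eq, hpr.deriv, he] at h1
  refine hUd.congr_deriv ?_
  have hr0 : r ≠ 0 := hr.1.ne'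
  have hp : r ^ (n - 1) = r ^ (n - 1 - 1) * r := by
    rw [← pow_succ]; congr 1; omega
  have hp0 : r ^ (n - 1 - 1) ≠ 0 := pow_ne_zero _ hr0
  rw [hp] at h1
  have h2 : ((n - 1 : ℕ) : ℝ) * derivWithin u (Icc 0 1) r + r * deriv (derivWithin u (Icc 0 1)) r
      = - (|u r| ^ (2 * e) * u r * r) := by
    apply mul_left_cancel₀ hp0
    linear_combination h1
  field_simp
  linear_combination h2

lemma data_of {n m : ℕ} (hm : 2 ≤ m) {p : ℝ} {u : ℝ → ℝ} {ρ δ : ℕ → ℝ}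
    (h : DirichletData n p m u ρ δ) :
    derivWithin u (Icc 0 1) 1 = deriv u 1 ∧ δ 1 ∈ Ioo (0 : ℝ) 1 ∧
    derivWithin u (Icc 0 1) (δ 1) = 0 ∧ u 1 = 0 ∧ (∀ t ∈ Ico (δ 1) 1, u t ≠ 0) ∧
    ∃ z : ℕ → ℝ, z 0 = 0 ∧ z m = 1 ∧ (∀ j < m, z j ≤ z (j + 1)) ∧
      (∀ j < m, ∀ t ∈ Ioo (z j) (z (j + 1)), u t ≠ 0) := by
  obtain ⟨hs, hu1, hρ1, hδm, hδρ, hρδ, hZ, hD⟩ := h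
  have hstep : ∀ k, 1 ≤ k → k + 1 ≤ m → ρ (k + 1) ≤ ρ k := fun k h1 h2 =>
    ((hρδ k h1 h2).trans (hδρ k h1 (by omega))).le
  have hanti : ∀ j k, 1 ≤ j → j ≤ k → k ≤ m → ρ k ≤ ρ j := by
    intro j k hj hjk
    induction k, hjk using Nat.le_induction with
    | base => intro _; exact le_rfl
    | succ k hk ih =>
      intro hkm
      exact (hstep k (by omega) hkm).trans (ih (by omega))
  have hmem : ∀ k, 1 ≤ k → k ≤ m → ρ k ∈ Ioc (0 : ℝ) 1 := by
    intro k h1 h2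
    have : ρ k ∈ {r : ℝ | r ∈ Set.Ioc (0 : ℝ) 1 ∧ u r = 0} := by
      rw [hZ]; exact ⟨k, ⟨h1, h2⟩, rfl⟩
    exact this.1
  have hzero : ∀ t ∈ Ioc (0 : ℝ) 1, u t = 0 → ∃ k, 1 ≤ k ∧ k ≤ m ∧ ρ k = t := by
    intro t ht h0
    have : t ∈ ρ '' Set.Icc 1 m := by rw [← hZ]; exact ⟨ht, h0⟩
    obtain ⟨k, hk, rfl⟩ := this
    exact ⟨k, hk.1, hk.2, rfl⟩
  have hne : deriv u 1 ≠ 0 := by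
    intro h0
    have : (1 : ℝ) ∈ δ '' Set.Icc 1 m := by rw [← hD]; exact ⟨⟨zero_le_one, le_rfl⟩, h0⟩
    obtain ⟨k, hk, h1⟩ := this
    have := hδρ k hk.1 hk.2
    linarith [(hmem k hk.1 hk.2).2]
  have hdiff : DifferentiableAt ℝ u 1 := by
    by_contra hc
    exact hne (deriv_zero_of_not_differentiableAt hc)
  have hδ : δ 1 ∈ Ioo (0 : ℝ) 1 := by
    refine ⟨?_, ?_⟩
    · exact (hmem 2 (by norm_num) hm).1.trans (hρδ 1 le_rfl hm)
    · rw [← hρ1]; exact hδρ 1 le_rfl (by omega)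
  refine ⟨hdiff.derivWithin (uniqueDiffOn_Icc zero_lt_one 1 ⟨zero_le_one, le_rfl⟩), hδ, ?_, hu1,
    ?_, ?_⟩
  · rw [derivWithin_of_mem_nhds (Icc_mem_nhds hδ.1 hδ.2)]
    have : δ 1 ∈ {r : ℝ | r ∈ Set.Icc (0 : ℝ) 1 ∧ deriv u r = 0} := by
      rw [hD]; exact ⟨1, ⟨le_rfl, by omega⟩, rfl⟩
    exact this.2
  · intro t ht h0
    obtain ⟨k, h1, h2, rfl⟩ := hzero t ⟨hδ.1.trans_le ht.1, ht.2.le⟩ h0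
    rcases Nat.lt_or_ge k 2 with hk | hk
    · have : k = 1 := by omega
      subst this
      rw [hρ1] at ht
      exact lt_irrefl _ ht.2
    · have := hanti 2 k (by norm_num) hk h2
      have h3 := hρδ 1 le_rfl hm
      norm_num at h3
      linarith [ht.1]
  · refine ⟨fun j => if j = 0 then 0 else ρ (m + 1 - j), by simp, ?_, ?_, ?_⟩
    · simp only [show m ≠ 0 by omega, if_false]
      rw [show m + 1 - m = 1 by omega, hρ1]
    · intro j hj
      simp only [Nat.succ_ne_zero, if_false]
      split_ifs with h0
      · exact (hmem _ (by omega) (by omega)).1.le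
      · exact hanti _ _ (by omega) (by omega) (by omega)
    · intro j hj t ht h0
      simp only [Nat.succ_ne_zero, if_false] at ht
      have hr1 := hmem (m + 1 - (j + 1)) (by omega) (by omega)
      split_ifs at ht with hj0
      · obtain ⟨k, h1, h2, rfl⟩ := hzero t ⟨ht.1, ht.2.le.trans hr1.2⟩ h0
        have := hanti k (m + 1 - (j + 1)) h1 (by omega) (by omega)
        linarith [ht.2]
      · have hr2 := hmem (m + 1 - j) (by omega) (by omega)
        obtain ⟨k, h1, h2, rfl⟩ := hzero t ⟨hr2.1.trans ht.1, ht.2.le.trans hr1.2⟩ h0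
        rcases Nat.lt_or_ge k (m + 1 - j) with hk | hk
        · have := hanti k (m + 1 - (j + 1)) h1 (by omega) (by omega)
          linarith [ht.2]
        · have := hanti (m + 1 - j) k (by omega) hk h2
          linarith [ht.1]

lemma Rad.bub {d : ℕ} (hd : 2 ≤ d) {e δ : ℝ} {u U : ℝ → ℝ} (h : Rad d e u U)
    (hδ : δ ∈ Ioo (0 : ℝ) 1) (hU : U δ = 0) (hu1 : u 1 = 0)
    (hpos : ∀ t ∈ Ico δ 1, 0 < u t) :
    Bub d e (u δ ^ e * δ) (u δ ^ e) (fun s => u (s / u δ ^ e) / u δ)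
      (fun s => -(s ^ d * U (s / u δ ^ e)) / (u δ ^ e * u δ)) := by
  have hM : 0 < u δ := hpos δ ⟨le_rfl, hδ.2⟩
  set M := u δ with hMd
  have hγ : 0 < M ^ e := Real.rpow_pos_of_pos hM e
  have hγ2 : M ^ (2 * e) = M ^ e * M ^ e := by
    rw [← Real.rpow_add hM]; congr 1; ring
  set γ := M ^ e with hγd
  have hδ0 := hδ.1
  have hmap : MapsTo (fun s => s / γ) (Icc (γ * δ) γ) (Icc 0 1) := by
    intro s hs
    refine ⟨?_, ?_⟩
    · have : 0 ≤ s := le_trans (by positivity) hs.1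
      positivity
    · simp only
      rw [div_le_one hγ]; exact hs.2
  have hin : ∀ s ∈ Ioo (γ * δ) γ, s / γ ∈ Ioo δ 1 := by
    intro s hs
    refine ⟨?_, ?_⟩
    · rw [lt_div_iff₀ hγ]; linarith [hs.1, mul_comm γ δ]
    · rw [div_lt_one hγ]; exact hs.2
  have hdd : ∀ s : ℝ, HasDerivAt (fun s => s / γ) (1 / γ) s := fun s =>
    (hasDerivAt_id s).div_const γ
  have hδe : γ * δ / γ = δ := by field_simp
  have cU1 : ContinuousOn (fun s => U (s / γ)) (Icc (γ * δ) γ) :=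
    h.cU.comp (by fun_prop) hmap
  have cu1 : ContinuousOn (fun s => u (s / γ)) (Icc (γ * δ) γ) :=
    h.cu.comp (by fun_prop) hmap
  refine ⟨by positivity, ?_, ?_, ?_, ?_, ?_, ?_, ?_, ?_, ?_⟩
  · nlinarith [hδ.2]
  · exact cu1.div_const _
  · exact ((continuousOn_id.pow d).mul cU1).neg.div_const _
  · intro s hs
    have h1 := hin s hs
    have hs0 : 0 < s := lt_trans (by positivity) hs.1
    have h2 := ((h.du (s / γ) ⟨hδ0.trans h1.1, h1.2⟩).comp s (hdd s)).div_const M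
    refine h2.congr_deriv ?_
    field_simp
  · intro s hs
    have h1 := hin s hs
    have hs0 : 0 < s := lt_trans (by positivity) hs.1
    have h2 := (((hasDerivAt_pow d s).mul
      ((h.dU (s / γ) ⟨hδ0.trans h1.1, h1.2⟩).comp s (hdd s))).neg).div_const (γ * M)
    refine h2.congr_deriv ?_
    have hup : 0 < u (s / γ) := hpos _ ⟨h1.1.le, h1.2⟩
    have e1 : (u (s / γ) / M) ^ (2 * e + 1) = u (s / γ) ^ (2 * e) * u (s / γ) / (γ * γ * M) := by
      rw [Real.rpow_add_one (by positivity), Real.div_rpow hup.le hM.le, hγ2]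
      field_simp
    have e2 : s ^ d = s ^ (d - 1) * s := by
      rw [← pow_succ]; congr 1; omega
    simp only [Function.comp_apply]
    rw [e1, abs_of_pos hup, e2]
    field_simp
    ring
  · rw [hδe, ← hMd, div_self hM.ne']
  · rw [hδe, hU]; simp
  · rw [div_self hγ.ne', hu1]; simp
  · intro s hs
    refine div_pos (hpos _ ⟨?_, ?_⟩) hM
    · rw [le_div_iff₀ hγ]; linarith [hs.1, mul_comm γ δ]
    · rw [div_lt_one hγ]; exact hs.2

lemma Rad.bub_abs {d : ℕ} (hd : 2 ≤ d) {e κ δ : ℝ} {u U : ℝ → ℝ} (h : Rad d e u U)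
    (hek : ((d : ℝ) - 1) * e = 2 - κ)
    (hδ : δ ∈ Ioo (0 : ℝ) 1) (hU : U δ = 0) (hu1 : u 1 = 0)
    (hne : ∀ t ∈ Ico δ 1, u t ≠ 0) :
    ∃ v q : ℝ → ℝ, Bub d e (|u δ| ^ e * δ) (|u δ| ^ e) v q ∧
      q (|u δ| ^ e) = |u δ| ^ (1 - κ) * |U 1| := by
  wlog hp : 0 < u δ generalizing u U
  · have h0 := hne δ ⟨le_rfl, hδ.2⟩
    have := this h.neg (by simp [hU]) (by simp [hu1]) (fun t ht => by simpa using hne t ht)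
      (by
        rcases lt_trichotomy (u δ) 0 with h | h | h
        · simpa using h
        · exact absurd h h0
        · exact absurd h hp)
    simpa using this
  have hpos : ∀ t ∈ Ico δ 1, 0 < u t := by
    intro t ht
    by_contra hc
    push Not at hc
    have hcont : ContinuousOn u (Icc δ t) :=
      h.cu.mono (Icc_subset_Icc hδ.1.le ht.2.le)
    obtain ⟨x, hx, hx0⟩ := intermediate_value_Icc' ht.1 hcont ⟨hc, hp.le⟩
    exact hne x ⟨hx.1, hx.2.trans_lt ht.2⟩ hx0
  have hB := h.bub hd hδ hU hu1 hpos
  rw [abs_of_pos hp]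
  refine ⟨_, _, hB, ?_⟩
  have hq := hB.qnonneg (s := u δ ^ e) ⟨hB.lt.le, le_rfl⟩
  have hγ : 0 < u δ ^ e := Real.rpow_pos_of_pos hp e
  rw [div_self hγ.ne'] at hq ⊢
  have e2 : (u δ ^ e) ^ d = (u δ ^ e) ^ (d - 1) * u δ ^ e := by
    rw [← pow_succ]; congr 1; omega
  have e3 : (u δ ^ e) ^ (d - 1) = u δ ^ (1 - κ) * u δ := by
    rw [← Real.rpow_natCast, ← Real.rpow_mul hp.le, ← Real.rpow_add_one hp.ne']
    congr 1
    rw [Nat.cast_sub (by omega)]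
    push_cast
    linarith
  have hk : 0 < u δ ^ (1 - κ) := Real.rpow_pos_of_pos hp _
  have e4 : -((u δ ^ e) ^ d * U 1) / (u δ ^ e * u δ) = u δ ^ (1 - κ) * (-U 1) := by
    rw [e2, e3]; field_simp
  rw [e4] at hq ⊢
  have : 0 ≤ -U 1 := nonneg_of_mul_nonneg_right hq hk
  rw [← abs_neg (U 1), abs_of_nonneg this]

lemma per_eps {n m : ℕ} (hn : 3 ≤ n) (hm : 2 ≤ m) {p e κ K X : ℝ} {u : ℝ → ℝ} {ρ δ : ℕ → ℝ}
    (h : DirichletData n p m u ρ δ) (hκ0 : 0 ≤ κ) (hκ : κ ≤ 1 / 2)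
    (hek : (((n - 1 : ℕ) : ℝ) - 1) * e = 2 - κ) (hp : p - 1 = 2 * e)
    (hK : K = (2 + ((n - 1 : ℕ) : ℝ)) * (6 * (1 + ((n - 1 : ℕ) : ℝ) ^ 2)) ^ ((n - 1 : ℕ) : ℝ))
    (hX : X = 6 * ((m : ℝ) * (2 * ((((n - 1 : ℕ) : ℝ) - 1) * κ / (2 - κ)) * K ^ 2)))
    (hX1 : X ≤ 1) :
    ∃ v q : ℝ → ℝ, Bub (n - 1) e (|u (δ 1)| ^ e * δ 1) (|u (δ 1)| ^ e) v q ∧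
      q (|u (δ 1)| ^ e) = |u (δ 1)| ^ (1 - κ) * |deriv u 1| ∧
      |u (δ 1)| ^ e * δ 1 ≤ X ^ (1 / (2 * ((n - 1 : ℕ) : ℝ))) := by
  have hR := rad_of hn h.1 hp
  obtain ⟨hU1, hδ, hUδ, hu1, hne, z, hz0, hzm, hz, hzu⟩ := data_of hm h
  have hd : 2 ≤ n - 1 := by omega
  generalize n - 1 = d at *
  have hd2 : (2 : ℝ) ≤ d := by exact_mod_cast hd
  have he : 0 < e := by
    by_contra hc
    push Not at hc
    nlinarith
  have he2 : e ≤ 2 := by nlinarith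
  have hed : 1 ≤ e * d := by nlinarith
  have hk2 : 0 < 2 - κ := by linarith
  have hθe : ((d : ℝ) - 1) / (2 - κ) * e = 1 := by
    rw [div_mul_eq_mul_div, hek, div_self hk2.ne']
  have hθ0 : 0 < ((d : ℝ) - 1) / (2 - κ) := div_pos (by linarith) hk2
  have hθd : ((d : ℝ) - 1) / (2 - κ) ≤ d - 1 := by
    rw [div_le_iff₀ hk2]; nlinarith
  have hα : ((d : ℝ) - 1) * κ / (2 - κ) = 2 * (((d : ℝ) - 1) / (2 - κ)) - ((d : ℝ) - 1) := by
    field_simp; ring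
  have hα0 : 0 ≤ ((d : ℝ) - 1) * κ / (2 - κ) :=
    div_nonneg (mul_nonneg (by linarith) hκ0) hk2.le
  have hE := hR.energy hd he hed he2 hθe hα hα0 hθ0 hK z hz0 m hzm hz hzu (by linarith)
  have hc := hR.crit he he2 hθe hα hα0 hθ0 hδ.1 hδ.2.le hUδ hE
  rw [← hX] at hc
  obtain ⟨v, q, hB, hq⟩ := hR.bub_abs hd hek hδ hUδ hu1 hne
  refine ⟨v, q, hB, by rw [hq, hU1], ?_⟩
  have hs0 : 0 < |u (δ 1)| ^ e * δ 1 := hB.hs0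
  generalize |u (δ 1)| ^ e * δ 1 = s at *
  generalize ((d : ℝ) - 1) / (2 - κ) = θ at *
  have hs1 : s ≤ 1 := by
    by_contra hcon
    push Not at hcon
    have := Real.one_lt_rpow hcon (by linarith : 0 < 2 * θ + 2)
    linarith
  have h3 : s ^ (2 * (d : ℝ)) ≤ X :=
    (Real.rpow_le_rpow_of_exponent_ge hs0 hs1 (by linarith)).trans hc
  have h4 := Real.rpow_le_rpow (by positivity) h3 (by positivity : 0 ≤ 1 / (2 * (d : ℝ)))
  rwa [← Real.rpow_mul hs0.le, mul_one_div_cancel (by positivity), Real.rpow_one] at h4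
/-- **Lemma 4.6.** For radial Dirichlet solutions with `m-1` interior zeros (largest
critical point `δ_{1,ε}`):
`|u_ε(δ_{1,ε})|^{1-ε(n-2)/2} |u_ε'(1)| → (n(n-2))^{n/2}/n` as `ε → 0⁺`. -/
theorem dirichlet_derivative_limit (n m : ℕ) (hn : 3 ≤ n) (hm : 2 ≤ m)
    (u : ℝ → ℝ → ℝ) (ρ δ : ℝ → ℕ → ℝ)
    (hu : ∀ ε ∈ Set.Ioo (0 : ℝ) (4 / ((n : ℝ) - 2)),
      DirichletData n (pEps n ε) m (u ε) (ρ ε) (δ ε)) :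
    Tendsto (fun ε : ℝ =>
        |u ε (δ ε 1)| ^ (1 - ε * ((n : ℝ) - 2) / 2) * |deriv (u ε) 1|)
      (𝓝[>] (0 : ℝ))
      (𝓝 (((n : ℝ) * ((n : ℝ) - 2)) ^ ((n : ℝ) / 2) / (n : ℝ))) := by
  have hn3 : (3 : ℝ) ≤ n := by exact_mod_cast hn
  have hd : 2 ≤ n - 1 := by omega
  have hcast : ((n - 1 : ℕ) : ℝ) = n - 1 := by rw [Nat.cast_sub (by omega)]; simp
  obtain ⟨K, hK⟩ : ∃ K : ℝ, K = (2 + ((n - 1 : ℕ) : ℝ)) *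
    (6 * (1 + ((n - 1 : ℕ) : ℝ) ^ 2)) ^ ((n - 1 : ℕ) : ℝ) := ⟨_, rfl⟩
  set κ : ℝ → ℝ := fun ε => ε * ((n : ℝ) - 2) / 2 with hκd
  set e : ℝ → ℝ := fun ε => (2 - κ ε) / ((n : ℝ) - 2) with hed
  set X : ℝ → ℝ := fun ε =>
    6 * ((m : ℝ) * (2 * ((((n - 1 : ℕ) : ℝ) - 1) * κ ε / (2 - κ ε)) * K ^ 2)) with hXd
  have hid : Tendsto (fun ε : ℝ => ε) (𝓝[>] (0 : ℝ)) (𝓝 0) :=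
    tendsto_nhdsWithin_of_tendsto_nhds tendsto_id
  have hκt : Tendsto κ (𝓝[>] (0 : ℝ)) (𝓝 0) := by
    have := (hid.mul_const ((n : ℝ) - 2)).div_const 2
    simpa using this
  have hXt : Tendsto X (𝓝[>] (0 : ℝ)) (𝓝 0) := by
    have := ((((hκt.const_mul (((n - 1 : ℕ) : ℝ) - 1)).div (hκt.const_sub 2) (by norm_num)).const_mul
      2).mul_const (K ^ 2)).const_mul (m : ℝ) |>.const_mul 6
    simpa using this
  have hkey : ∀ ε, ∃ v q : ℝ → ℝ, (0 < ε ∧ κ ε ≤ 1 / 2 ∧ X ε ≤ 1) →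
      Bub (n - 1) (e ε) (|u ε (δ ε 1)| ^ e ε * δ ε 1) (|u ε (δ ε 1)| ^ e ε) v q ∧
      q (|u ε (δ ε 1)| ^ e ε) = |u ε (δ ε 1)| ^ (1 - κ ε) * |deriv (u ε) 1| ∧
      |u ε (δ ε 1)| ^ e ε * δ ε 1 ≤ X ε ^ (1 / (2 * ((n - 1 : ℕ) : ℝ))) := by
    intro ε
    by_cases hg : 0 < ε ∧ κ ε ≤ 1 / 2 ∧ X ε ≤ 1
    · obtain ⟨h0, h1, h2⟩ := hg
      have hlt : ε < 4 / ((n : ℝ) - 2) := by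
        rw [lt_div_iff₀ (by linarith)]
        simp only [hκd] at h1
        linarith
      have hk0 : 0 ≤ κ ε := by
        simp only [hκd]
        have : 0 ≤ (n : ℝ) - 2 := by linarith
        positivity
      have hn2 : (n : ℝ) - 2 ≠ 0 := by linarith
      obtain ⟨v, q, h⟩ := per_eps (e := e ε) (κ := κ ε) (K := K) (X := X ε) hn hm (hu ε ⟨h0, hlt⟩)
        hk0 h1 (by
          rw [hcast]
          simp only [hed]
          field_simp
          ring) (by
          simp only [hed, hκd, pEps]
          field_simp
          ring) hK rfl h2
      exact ⟨v, q, fun _ => h⟩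
    · exact ⟨fun _ => 0, fun _ => 0, fun h => absurd h hg⟩
  choose v q hvq using hkey
  have hpos : ∀ᶠ ε in 𝓝[>] (0 : ℝ), 0 < ε := self_mem_nhdsWithin
  have hgood : ∀ᶠ ε in 𝓝[>] (0 : ℝ), 0 < ε ∧ κ ε ≤ 1 / 2 ∧ X ε ≤ 1 := by
    filter_upwards [hpos, hκt.eventually_le_const (by norm_num : (0 : ℝ) < 1 / 2),
      hXt.eventually_le_const zero_lt_one] with ε h0 h1 h2
    exact ⟨h0, h1, h2⟩
  have hgk : ∀ᶠ ε in 𝓝[>] (0 : ℝ), 0 ≤ κ ε := by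
    filter_upwards [hpos] with ε h0
    have : 0 ≤ (n : ℝ) - 2 := by linarith
    simp only [hκd]
    positivity
  set s0 : ℝ → ℝ := fun ε => |u ε (δ ε 1)| ^ e ε * δ ε 1 with hs0d
  have hd0 : (0 : ℝ) < 1 / (2 * ((n - 1 : ℕ) : ℝ)) := by
    rw [hcast]
    have : (0 : ℝ) < n - 1 := by linarith
    positivity
  have hs0t : Tendsto s0 (𝓝[>] (0 : ℝ)) (𝓝 0) := by
    have hX2 := hXt.rpow_const (p := 1 / (2 * ((n - 1 : ℕ) : ℝ))) (Or.inr hd0.le)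
    rw [Real.zero_rpow hd0.ne'] at hX2
    refine tendsto_of_tendsto_of_tendsto_of_le_of_le' tendsto_const_nhds hX2 ?_ ?_
    · filter_upwards [hgood] with ε hg
      exact (hvq ε hg).1.hs0.le
    · filter_upwards [hgood] with ε hg
      exact (hvq ε hg).2.2
  have hs1t : Tendsto (fun ε => max (√(s0 ε)) ε) (𝓝[>] (0 : ℝ)) (𝓝 0) := by
    have := ((Real.continuous_sqrt.tendsto 0).comp hs0t).max hid
    simpa using this
  have hlog : Tendsto (fun ε : ℝ => ε ^ κ ε) (𝓝[>] (0 : ℝ)) (𝓝 1) := by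
    have h1 : Tendsto (fun ε : ℝ => Real.log ε * ε ^ (1 : ℝ)) (𝓝[>] (0 : ℝ)) (𝓝 0) :=
      tendsto_log_mul_rpow_nhdsGT_zero zero_lt_one
    have h2 := (Real.continuous_exp.tendsto _).comp (h1.mul_const (((n : ℝ) - 2) / 2))
    rw [zero_mul, Real.exp_zero] at h2
    refine h2.congr' ?_
    filter_upwards [hpos] with ε h0
    rw [Real.rpow_def_of_pos h0]
    simp only [Function.comp_apply, hκd, Real.rpow_one]
    congr 1
    ring
  have hlim := bubble_limit (l := 𝓝[>] (0 : ℝ)) (d := n - 1) hd (κ := κ) (e := e) (s0 := s0)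
    (g := fun ε => |u ε (δ ε 1)| ^ e ε) (s1 := fun ε => max (√(s0 ε)) ε) (v := v) (q := q)
    (hgood.mono fun ε hg => (hvq ε hg).1) hgk hκt
    (Eventually.of_forall fun ε => by
      have hn2 : (n : ℝ) - 2 ≠ 0 := by linarith
      rw [hcast]
      simp only [hed]
      field_simp
      ring)
    (hpos.mono fun ε h0 => lt_max_of_lt_right h0) hs1t
    (hgood.mono fun ε hg => by
      have h0 := (hvq ε hg).1.hs0
      calc s0 ε = √(s0 ε) ^ 2 := (Real.sq_sqrt h0.le).symm
        _ ≤ _ := by gcongr; exact le_max_left _ _)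
    (by
      refine tendsto_of_tendsto_of_tendsto_of_le_of_le' hlog tendsto_const_nhds ?_ ?_
      · filter_upwards [hpos, hgk] with ε h0 h1
        exact Real.rpow_le_rpow h0.le (le_max_right _ _) h1
      · filter_upwards [hpos, hgk, hs1t.eventually_le_const zero_lt_one] with ε h0 h1 h2
        exact Real.rpow_le_one (h0.le.trans (le_max_right _ _)) h2 h1)
  have hL : L0 (n - 1) = ((n : ℝ) * ((n : ℝ) - 2)) ^ ((n : ℝ) / 2) / (n : ℝ) := by
    unfold L0
    rw [hcast]
    have e1 : (n : ℝ) - 1 + 1 = n := by ring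
    have e2 : (n : ℝ) - 1 - 1 = n - 2 := by ring
    rw [e1, e2]
  rw [hL] at hlim
  refine hlim.congr' ?_
  filter_upwards [hgood] with ε hg
  exact (hvq ε hg).2.1
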